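/- arXiv:2306.08065 — 2 statements merged into one kernel-verified Lean document; each statement's English description precedes it below -/
import Mathlib

section
/- The patterns 3142 and 4132 are (Destop, Desbot, Ascbot, Val, RLmin)-Wilf equivalent: for every n ≥ 0 and all sets T, B, A, V, R ⊆ [n], the number of permutations σ ∈ Av_n(3142) with Destop(σ) = T, Desbot(σ) = B, Ascbot(σ) = A, Val(σ) = V, and RLmin(σ) = R equals the number of permutations σ ∈ Av_n(4132) with the same five set values. -/
open scoped Classical

/-- The 1-based `i`-th entry of a permutation `σ` of `{1,…,n}`, as a value in `{1,…,n}`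
(one-line notation `σ(1)…σ(n)`). -/
def entry {n : ℕ} (σ : Equiv.Perm (Fin n)) (i : ℕ) : ℕ :=
  if h : i - 1 < n then (σ ⟨i - 1, h⟩ : ℕ) + 1 else 0

/-- `σ` contains the pattern `π ∈ S_k` (given in 0-based one-line notation as a function):
there is a (not necessarily consecutive) subsequence of `σ` order-isomorphic to `π`. -/
def Contains {n k : ℕ} (π : Fin k → Fin k) (σ : Equiv.Perm (Fin n)) : Prop :=
  ∃ f : Fin k → Fin n, StrictMono f ∧ ∀ i j : Fin k, π i < π j ↔ σ (f i) < σ (f j)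

/-- `σ` avoids the pattern `π`. -/
def AvoidsPat {n k : ℕ} (π : Fin k → Fin k) (σ : Equiv.Perm (Fin n)) : Prop :=
  ¬ Contains π σ

/-- The descent set of `σ` (1-based positions `i ∈ [n-1]` with `σ(i) > σ(i+1)`). -/
def Des {n : ℕ} (σ : Equiv.Perm (Fin n)) : Finset ℕ :=
  (Finset.Icc 1 (n - 1)).filter (fun i => entry σ (i + 1) < entry σ i)

/-- The descent top set of `σ`: `{σ(i) : i ∈ Des σ}`. -/
def Destop {n : ℕ} (σ : Equiv.Perm (Fin n)) : Finset ℕ :=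
  (Des σ).image (entry σ)

/-- The descent bottom set of `σ`: `{σ(i+1) : i ∈ Des σ}`. -/
def Desbot {n : ℕ} (σ : Equiv.Perm (Fin n)) : Finset ℕ :=
  (Des σ).image (fun i => entry σ (i + 1))

/-- The ascent set of `σ` (1-based positions `i ∈ [n-1]` with `σ(i) < σ(i+1)`). -/
def Asc {n : ℕ} (σ : Equiv.Perm (Fin n)) : Finset ℕ :=
  (Finset.Icc 1 (n - 1)).filter (fun i => entry σ i < entry σ (i + 1))

/-- The ascent top set of `σ`: `{σ(i+1) : i ∈ Asc σ}`. -/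
def Asctop {n : ℕ} (σ : Equiv.Perm (Fin n)) : Finset ℕ :=
  (Asc σ).image (fun i => entry σ (i + 1))

/-- The ascent bottom set of `σ`: `{σ(i) : i ∈ Asc σ}`. -/
def Ascbot {n : ℕ} (σ : Equiv.Perm (Fin n)) : Finset ℕ :=
  (Asc σ).image (entry σ)

/-- The set of peak values of `σ`. -/
def Peak {n : ℕ} (σ : Equiv.Perm (Fin n)) : Finset ℕ :=
  Destop σ ∩ Asctop σ

/-- The set of valley values of `σ`. -/
def Val {n : ℕ} (σ : Equiv.Perm (Fin n)) : Finset ℕ :=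
  Desbot σ ∩ Ascbot σ

/-- The set of left-to-right maxima (as values) of `σ`. -/
noncomputable def LRmax {n : ℕ} (σ : Equiv.Perm (Fin n)) : Finset ℕ :=
  ((Finset.Icc 1 n).filter (fun i => ∀ j, 1 ≤ j → j < i → entry σ j < entry σ i)).image (entry σ)

/-- The set of left-to-right minima (as values) of `σ`. -/
noncomputable def LRmin {n : ℕ} (σ : Equiv.Perm (Fin n)) : Finset ℕ :=
  ((Finset.Icc 1 n).filter (fun i => ∀ j, 1 ≤ j → j < i → entry σ i < entry σ j)).image (entry σ)

/-- The set of right-to-left maxima (as values) of `σ`. -/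
noncomputable def RLmax {n : ℕ} (σ : Equiv.Perm (Fin n)) : Finset ℕ :=
  ((Finset.Icc 1 n).filter (fun i => ∀ j, i < j → j ≤ n → entry σ j < entry σ i)).image (entry σ)

/-- The set of right-to-left minima (as values) of `σ`. -/
noncomputable def RLmin {n : ℕ} (σ : Equiv.Perm (Fin n)) : Finset ℕ :=
  ((Finset.Icc 1 n).filter (fun i => ∀ j, i < j → j ≤ n → entry σ i < entry σ j)).image (entry σ)

/-- `(T, B)` is a descent matching: `T` and `B` are finite sets of positive integers
with `|T| = |B| = k`, and writing `T = {t_1 < … < t_k}`, `B = {b_1 < … < b_k}`,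
we have `t_i > b_i` for all `i ∈ [k]`. -/
def DescentMatching (T B : Finset ℕ) : Prop :=
  T.card = B.card ∧ (∀ t ∈ T, 0 < t) ∧ (∀ b ∈ B, 0 < b) ∧
    ∀ i < T.card, (B.sort (· ≤ ·)).getD i 0 < (T.sort (· ≤ ·)).getD i 0

/-- `(2_v 31)σ`: the number of occurrences of the vincular pattern `2-31` in `σ`
in which the "2" has value `v`. -/
def occ2_31at {n : ℕ} (σ : Equiv.Perm (Fin n)) (v : ℕ) : ℕ :=
  ((Finset.Icc 1 (n - 1) ×ˢ Finset.Icc 1 (n - 1)).filter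
    (fun p => p.1 < p.2 ∧ entry σ (p.2 + 1) < entry σ p.2 ∧
      entry σ (p.2 + 1) < entry σ p.1 ∧ entry σ p.1 = v ∧ v < entry σ p.2)).card

/-- `(31 2_v)σ`: the number of occurrences of the vincular pattern `31-2` in `σ`
in which the "2" has value `v`. -/
def occ31_2at {n : ℕ} (σ : Equiv.Perm (Fin n)) (v : ℕ) : ℕ :=
  ((Finset.Icc 1 (n - 1) ×ˢ Finset.Icc 1 n).filter
    (fun p => p.1 + 1 < p.2 ∧ entry σ (p.1 + 1) < entry σ p.1 ∧
      entry σ (p.1 + 1) < entry σ p.2 ∧ entry σ p.2 = v ∧ v < entry σ p.1)).card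

/-- `(2-31)σ`: the number of occurrences of the vincular pattern `2-31` in `σ`. -/
def occ2_31 {n : ℕ} (σ : Equiv.Perm (Fin n)) : ℕ :=
  ((Finset.Icc 1 (n - 1) ×ˢ Finset.Icc 1 (n - 1)).filter
    (fun p => p.1 < p.2 ∧ entry σ (p.2 + 1) < entry σ p.2 ∧
      entry σ (p.2 + 1) < entry σ p.1 ∧ entry σ p.1 < entry σ p.2)).card

/-- `(31-2)σ`: the number of occurrences of the vincular pattern `31-2` in `σ`. -/
def occ31_2 {n : ℕ} (σ : Equiv.Perm (Fin n)) : ℕ :=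
  ((Finset.Icc 1 (n - 1) ×ˢ Finset.Icc 1 n).filter
    (fun p => p.1 + 1 < p.2 ∧ entry σ (p.1 + 1) < entry σ p.1 ∧
      entry σ (p.1 + 1) < entry σ p.2 ∧ entry σ p.2 < entry σ p.1)).card

/-- The signature function `sg_{(T,B)}(i) = |B_{<i}| - |T_{≤i}| + 1`. -/
def sg (T B : Finset ℕ) (i : ℕ) : ℕ :=
  (B.filter (fun b => b < i)).card - (T.filter (fun t => t ≤ i)).card + 1

/-- The `(p,q)`-integer `[m]_{p,q} = Σ_{a+b=m-1} p^a q^b`. -/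
def genQInt {R : Type*} [CommRing R] (m : ℕ) (p q : R) : R :=
  ∑ a ∈ Finset.range m, p ^ a * q ^ (m - 1 - a)

/-- The reverse complement of `σ`: `σ^{rc}(i) = n + 1 - σ(n + 1 - i)`. -/
def revComp {n : ℕ} (σ : Equiv.Perm (Fin n)) : Equiv.Perm (Fin n) :=
  (Fin.revPerm.trans σ).trans Fin.revPerm




namespace Wilf

theorem sub2_append {a b : ℕ} {P Q : List ℕ} : [a,b].Sublist (P ++ Q) ↔
    [a,b].Sublist P ∨ (a ∈ P ∧ b ∈ Q) ∨ [a,b].Sublist Q := by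
  rw [List.sublist_append_iff]
  constructor
  · rintro ⟨l₁, l₂, h, h1, h2⟩
    rcases l₁ with _ | ⟨x, _ | ⟨y, _ | ⟨z, l⟩⟩⟩ <;> simp at h
    · subst h; exact Or.inr (Or.inr h2)
    · obtain ⟨rfl, rfl⟩ := h; simp at h1 h2; tauto
    · obtain ⟨rfl, rfl, rfl⟩ := h; tauto
  · rintro (h | ⟨h, h'⟩ | h)
    · exact ⟨[a,b], [], by simp, h, by simp⟩
    · exact ⟨[a], [b], by simp, by simpa using h, by simpa using h'⟩
    · exact ⟨[], [a,b], by simp, by simp, h⟩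

theorem sub3_append {a b c : ℕ} {P Q : List ℕ} : [a,b,c].Sublist (P ++ Q) ↔
    [a,b,c].Sublist P ∨ ([a,b].Sublist P ∧ c ∈ Q) ∨ (a ∈ P ∧ [b,c].Sublist Q) ∨
      [a,b,c].Sublist Q := by
  rw [List.sublist_append_iff]
  constructor
  · rintro ⟨l₁, l₂, h, h1, h2⟩
    rcases l₁ with _ | ⟨x, _ | ⟨y, _ | ⟨z, _ | ⟨u, l⟩⟩⟩⟩ <;> simp at h
    · subst h; tauto
    · obtain ⟨rfl, rfl⟩ := h; simp at h1; tauto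
    · obtain ⟨rfl, rfl, rfl⟩ := h; simp at h2; tauto
    · obtain ⟨rfl, rfl, rfl, rfl⟩ := h; tauto
  · rintro (h | ⟨h, h'⟩ | ⟨h, h'⟩ | h)
    · exact ⟨[a,b,c], [], by simp, h, by simp⟩
    · exact ⟨[a,b], [c], by simp, h, by simpa using h'⟩
    · exact ⟨[a], [b,c], by simp, by simpa using h, h'⟩
    · exact ⟨[], [a,b,c], by simp, by simp, h⟩

theorem sub4_append {a b c d : ℕ} {P Q : List ℕ} : [a,b,c,d].Sublist (P ++ Q) ↔
    [a,b,c,d].Sublist P ∨ ([a,b,c].Sublist P ∧ d ∈ Q) ∨ ([a,b].Sublist P ∧ [c,d].Sublist Q) ∨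
      (a ∈ P ∧ [b,c,d].Sublist Q) ∨ [a,b,c,d].Sublist Q := by
  rw [List.sublist_append_iff]
  constructor
  · rintro ⟨l₁, l₂, h, h1, h2⟩
    rcases l₁ with _ | ⟨x, _ | ⟨y, _ | ⟨z, _ | ⟨u, _ | ⟨v, l⟩⟩⟩⟩⟩ <;> simp at h
    · subst h; tauto
    · obtain ⟨rfl, rfl⟩ := h; simp at h1; tauto
    · obtain ⟨rfl, rfl, rfl⟩ := h; tauto
    · obtain ⟨rfl, rfl, rfl, rfl⟩ := h; simp at h2; tauto
    · obtain ⟨rfl, rfl, rfl, rfl, rfl⟩ := h; tauto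
  · rintro (h | ⟨h, h'⟩ | ⟨h, h'⟩ | ⟨h, h'⟩ | h)
    · exact ⟨[a,b,c,d], [], by simp, h, by simp⟩
    · exact ⟨[a,b,c], [d], by simp, h, by simpa using h'⟩
    · exact ⟨[a,b], [c,d], by simp, h, h'⟩
    · exact ⟨[a], [b,c,d], by simp, by simpa using h, h'⟩
    · exact ⟨[], [a,b,c,d], by simp, by simp, h⟩

theorem sub2_cons {a b x : ℕ} {Q : List ℕ} : [a,b].Sublist (x :: Q) ↔
    (a = x ∧ b ∈ Q) ∨ [a,b].Sublist Q := by
  rw [show x :: Q = [x] ++ Q from rfl, sub2_append]; simp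
theorem sub3_cons {a b c x : ℕ} {Q : List ℕ} : [a,b,c].Sublist (x :: Q) ↔
    (a = x ∧ [b,c].Sublist Q) ∨ [a,b,c].Sublist Q := by
  rw [show x :: Q = [x] ++ Q from rfl, sub3_append]; simp
theorem sub4_cons {a b c d x : ℕ} {Q : List ℕ} : [a,b,c,d].Sublist (x :: Q) ↔
    (a = x ∧ [b,c,d].Sublist Q) ∨ [a,b,c,d].Sublist Q := by
  rw [show x :: Q = [x] ++ Q from rfl, sub4_append]; simp

def S2 (a b : ℕ) (w : List ℕ) : Prop := [a,b].Sublist w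
def S3 (a b c : ℕ) (w : List ℕ) : Prop := [a,b,c].Sublist w
def S4 (a b c d : ℕ) (w : List ℕ) : Prop := [a,b,c,d].Sublist w

theorem S2_append {a b : ℕ} {P Q : List ℕ} : S2 a b (P ++ Q) ↔
    S2 a b P ∨ (a ∈ P ∧ b ∈ Q) ∨ S2 a b Q := sub2_append
theorem S3_append {a b c : ℕ} {P Q : List ℕ} : S3 a b c (P ++ Q) ↔
    S3 a b c P ∨ (S2 a b P ∧ c ∈ Q) ∨ (a ∈ P ∧ S2 b c Q) ∨ S3 a b c Q := sub3_append
theorem S4_append {a b c d : ℕ} {P Q : List ℕ} : S4 a b c d (P ++ Q) ↔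
    S4 a b c d P ∨ (S3 a b c P ∧ d ∈ Q) ∨ (S2 a b P ∧ S2 c d Q) ∨
      (a ∈ P ∧ S3 b c d Q) ∨ S4 a b c d Q := sub4_append
theorem S2_cons {a b x : ℕ} {Q : List ℕ} : S2 a b (x :: Q) ↔
    (a = x ∧ b ∈ Q) ∨ S2 a b Q := sub2_cons
theorem S3_cons {a b c x : ℕ} {Q : List ℕ} : S3 a b c (x :: Q) ↔
    (a = x ∧ S2 b c Q) ∨ S3 a b c Q := sub3_cons
theorem S4_cons {a b c d x : ℕ} {Q : List ℕ} : S4 a b c d (x :: Q) ↔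
    (a = x ∧ S3 b c d Q) ∨ S4 a b c d Q := sub4_cons
theorem S2_nil {a b : ℕ} : ¬ S2 a b [] := by simp [S2]
theorem S3_nil {a b c : ℕ} : ¬ S3 a b c [] := by simp [S3]
theorem S4_nil {a b c d : ℕ} : ¬ S4 a b c d [] := by simp [S4]
theorem S2.mem {a b : ℕ} {P : List ℕ} (h : S2 a b P) : a ∈ P ∧ b ∈ P :=
  ⟨h.subset (by simp), h.subset (by simp)⟩
theorem S3.mem {a b c : ℕ} {P : List ℕ} (h : S3 a b c P) : a ∈ P ∧ b ∈ P ∧ c ∈ P :=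
  ⟨h.subset (by simp), h.subset (by simp), h.subset (by simp)⟩

def CA (w : List ℕ) : Prop := ∃ a b c d, S4 a b c d w ∧ b < d ∧ d < a ∧ a < c
def CB (w : List ℕ) : Prop := ∃ a b c d, S4 a b c d w ∧ b < d ∧ d < c ∧ c < a

/-- Child word -/
def cw (N n : ℕ) (b t : Bool) (P Q : List ℕ) : List ℕ :=
  P ++ ((if b then [N] else []) ++ n :: (if t then Q else N :: Q))

theorem CA_cw {N n : ℕ} (hn : n < N) {b t : Bool} {P Q : List ℕ}
    (hP : ∀ x ∈ P, x < n ∨ x = N) (hQ : ∀ x ∈ Q, x < n ∨ x = N) :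
    CA (cw N n b t P Q) ↔ CA (P ++ N :: Q) ∨ ∃ x y, S3 x N y Q ∧ x < y ∧ y < N := by
  constructor
  · rintro ⟨p, q, r, s, h, h1, h2, h3⟩
    have key : (S4 p q r s (P ++ N :: Q) ∨ S4 p q N s (P ++ N :: Q) ∨
        S3 q N s Q) ∧ p < N := by
      have m3 : S3 q r s Q → r ∈ Q := fun h => h.mem.2.1
      have m3' : S3 p q r P → p ∈ P ∧ r ∈ P := fun h => ⟨h.mem.1, h.mem.2.2⟩
      have := hP p
      have m2 : S2 p q P → p ∈ P := fun h => h.mem.1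
      have m2' : S2 r s Q → r ∈ Q ∧ s ∈ Q := fun h => h.mem
      have rr : ∀ (R : List ℕ), (∀ x ∈ R, x < n ∨ x = N) → S4 p q r s R → r < n ∨ r = N :=
        fun R h k => h r (k.subset (by simp))
      have := rr P hP
      have := rr Q hQ
      have := hP r
      have := hQ r
      have := hQ s
      clear rr hP hQ
      cases b <;> cases t <;> simp [cw, S4_append, S4_cons, S3_cons, S2_cons] at h ⊢ <;>
      grind
    obtain ⟨k | k | k, hp⟩ := key
    · exact Or.inl ⟨p, q, r, s, k, h1, h2, h3⟩
    · exact Or.inl ⟨p, q, N, s, k, h1, h2, by omega⟩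
    · exact Or.inr ⟨q, s, k, h1, by omega⟩
  · rintro (⟨p, q, r, s, h, h1, h2, h3⟩ | ⟨q, s, h, h1, h2⟩)
    · have key : (S4 p q r s (cw N n b t P Q)) ∨ (S4 p q n s (cw N n b t P Q) ∧ p < n) := by
        have m2 : S2 p q P → p ∈ P := fun h => h.mem.1
        have := hP p
        have m3 : S3 q r s Q → r ∈ Q := fun h => h.mem.2.1
        have := hQ r
        have m3' : S3 p q r P → p ∈ P ∧ r ∈ P := fun h => ⟨h.mem.1, h.mem.2.2⟩
        have m2' : S2 r s Q → r ∈ Q ∧ s ∈ Q := fun h => h.mem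
        have := hP r
        have := hQ s
        clear hP hQ
        cases b <;> cases t <;> simp [cw, S4_append, S4_cons, S3_cons, S2_cons] at h ⊢ <;>
        grind
      obtain k | k := key
      · exact ⟨p, q, r, s, k, h1, h2, h3⟩
      · exact ⟨p, q, n, s, k.1, h1, h2, k.2⟩
    · refine ⟨n, q, N, s, ?_, h1, ?_, hn⟩
      · cases b <;> cases t <;> simp [cw, S4_append, S4_cons, S3_cons, S2_cons] <;> grind
      · have := hQ s h.mem.2.2; omega

theorem CB_cw {N n : ℕ} (hn : n < N) {b t : Bool} {P Q : List ℕ}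
    (hP : ∀ x ∈ P, x < n ∨ x = N) (hQ : ∀ x ∈ Q, x < n ∨ x = N) :
    CB (cw N n b t P Q) ↔ CB (P ++ N :: Q) ∨ ∃ x y, S2 N x P ∧ y ∈ Q ∧ x < y ∧ y < N := by
  constructor
  · rintro ⟨p, q, r, s, h, h1, h2, h3⟩
    have key : S4 p q r s (P ++ N :: Q) ∨ (S4 N q r s (P ++ N :: Q) ∧ r < N) ∨
        (S2 N q P ∧ s ∈ Q ∧ s < N) := by
      have m3 : S3 q r s Q → r ∈ Q := fun h => h.mem.2.1
      have m3' : S3 p q r P → p ∈ P ∧ r ∈ P := fun h => ⟨h.mem.1, h.mem.2.2⟩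
      have m2 : S2 p q P → p ∈ P := fun h => h.mem.1
      have m2' : S2 r s Q → r ∈ Q ∧ s ∈ Q := fun h => h.mem
      have := hP p
      have := hP r
      have := hQ r
      have := hQ s
      clear hP hQ
      cases b <;> cases t <;> simp [cw, S4_append, S4_cons, S3_cons, S2_cons] at h ⊢ <;>
      grind
    obtain k | k | k := key
    · exact Or.inl ⟨p, q, r, s, k, h1, h2, h3⟩
    · exact Or.inl ⟨N, q, r, s, k.1, h1, h2, k.2⟩
    · exact Or.inr ⟨q, s, k.1, k.2.1, h1, k.2.2⟩
  · rintro (⟨p, q, r, s, h, h1, h2, h3⟩ | ⟨q, s, h, hs, h1, h2⟩)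
    · have key : (S4 p q r s (cw N n b t P Q)) ∨ (S4 n q r s (cw N n b t P Q) ∧ r < n) := by
        have m3 : S3 q r s Q → r ∈ Q := fun h => h.mem.2.1
        have := hQ r
        have m2 : S2 p q P → p ∈ P := fun h => h.mem.1
        have := hP p
        have m3' : S3 p q r P → p ∈ P ∧ r ∈ P := fun h => ⟨h.mem.1, h.mem.2.2⟩
        have m2' : S2 r s Q → r ∈ Q ∧ s ∈ Q := fun h => h.mem
        have := hP r
        have := hQ s
        clear hP hQ
        cases b <;> cases t <;> simp [cw, S4_append, S4_cons, S3_cons, S2_cons] at h ⊢ <;>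
        grind
      obtain k | k := key
      · exact ⟨p, q, r, s, k, h1, h2, h3⟩
      · exact ⟨n, q, r, s, k.1, h1, h2, k.2⟩
    · refine ⟨N, q, n, s, ?_, h1, ?_, hn⟩
      · cases b <;> cases t <;> simp [cw, S4_append, S4_cons, S3_cons, S2_cons] <;> grind
      · have := hQ s hs; omega


def Adj (x y : ℕ) (w : List ℕ) : Prop := ∃ U V, w = U ++ x :: y :: V

theorem Adj_nil {x y : ℕ} : ¬ Adj x y [] := by
  rintro ⟨U, V, h⟩; simp at h

theorem Adj_cons {x y a : ℕ} {Q : List ℕ} : Adj x y (a :: Q) ↔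
    (x = a ∧ Q.head? = some y) ∨ Adj x y Q := by
  constructor
  · rintro ⟨U, V, h⟩
    rcases U with _ | ⟨u, U⟩
    · simp at h; left; simp [h.1, h.2]
    · simp at h; right; exact ⟨U, V, h.2⟩
  · rintro (⟨rfl, h⟩ | ⟨U, V, rfl⟩)
    · rcases Q with _ | ⟨q, Q⟩ <;> simp at h
      subst h; exact ⟨[], Q, rfl⟩
    · exact ⟨a :: U, V, rfl⟩

theorem Adj_append {x y : ℕ} {P Q : List ℕ} : Adj x y (P ++ Q) ↔
    Adj x y P ∨ (P.getLast? = some x ∧ Q.head? = some y) ∨ Adj x y Q := by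
  induction P with
  | nil => simp [Adj_nil]
  | cons p P ih =>
    rw [List.cons_append, Adj_cons, Adj_cons, ih]
    rcases P with _ | ⟨p', P⟩
    · simp [Adj_nil]; tauto
    · simp [List.getLast?_cons_cons]; tauto

theorem Adj.mem {x y : ℕ} {P : List ℕ} (h : Adj x y P) : x ∈ P ∧ y ∈ P := by
  obtain ⟨U, V, rfl⟩ := h; simp

def TT (N : ℕ) (w : List ℕ) (x : ℕ) : Prop := x < N ∧ ∃ y, Adj x y w ∧ y < x
def BB (N : ℕ) (w : List ℕ) (x : ℕ) : Prop := x < N ∧ ∃ y, Adj y x w ∧ x < y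
def RR (N : ℕ) (w : List ℕ) (x : ℕ) : Prop := x < N ∧ x ∈ w ∧ ∀ y, S2 x y w → x < y

theorem TT_cw {N n : ℕ} (hn : n < N) {b t : Bool} {P Q : List ℕ}
    (hP : ∀ x ∈ P, x < n ∨ x = N) (hQ : ∀ x ∈ Q, x < n ∨ x = N)
    (ht : t = true → ∃ q, Q.head? = some q ∧ q < n) (x : ℕ) :
    TT N (cw N n b t P Q) x ↔ TT N (P ++ N :: Q) x ∨ (x = n ∧ t = true) := by
  have hl : ∀ z, P.getLast? = some z → z < n ∨ z = N := fun z hz => hP z (List.mem_of_getLast? hz)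
  have hh : ∀ z, Q.head? = some z → z < n ∨ z = N := fun z hz => hQ z (List.mem_of_head? hz)
  constructor
  · rintro ⟨h1, y, h2, h3⟩
    by_cases hx : x = n ∧ t = true
    · exact Or.inr hx
    · refine Or.inl ⟨h1, y, ?_, h3⟩
      cases b <;> cases t <;> simp [cw, Adj_append, Adj_cons] at h2 ht hx ⊢ <;> grind
  · rintro (⟨h1, y, h2, h3⟩ | ⟨rfl, rfl⟩)
    · refine ⟨h1, y, ?_, h3⟩
      cases b <;> cases t <;> simp [cw, Adj_append, Adj_cons] at h2 ht ⊢ <;> grind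
    · obtain ⟨q, hq, hq'⟩ := ht rfl
      refine ⟨hn, q, ?_, hq'⟩
      cases b <;> simp [cw, Adj_append, Adj_cons, hq]

theorem BB_cw {N n : ℕ} (hn : n < N) {b t : Bool} {P Q : List ℕ}
    (hP : ∀ x ∈ P, x < n ∨ x = N) (hQ : ∀ x ∈ Q, x < n ∨ x = N)
    (ht : t = true → ∃ q, Q.head? = some q ∧ q < n) (hPl : P.getLast? ≠ some N) (x : ℕ) :
    BB N (cw N n b t P Q) x ↔ BB N (P ++ N :: Q) x ∨ (x = n ∧ b = true) := by
  have hl : ∀ z, P.getLast? = some z → z < n ∨ z = N := fun z hz => hP z (List.mem_of_getLast? hz)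
  have hh : ∀ z, Q.head? = some z → z < n ∨ z = N := fun z hz => hQ z (List.mem_of_head? hz)
  constructor
  · rintro ⟨h1, y, h2, h3⟩
    by_cases hx : x = n ∧ b = true
    · exact Or.inr hx
    · refine Or.inl ⟨h1, ?_⟩
      have : Adj y x (P ++ N :: Q) ∨ Adj N x (P ++ N :: Q) := by
        cases b <;> cases t <;> simp [cw, Adj_append, Adj_cons] at h2 ht hx ⊢ <;> grind
      rcases this with h | h
      · exact ⟨y, h, h3⟩
      · exact ⟨N, h, h1⟩
  · rintro (⟨h1, y, h2, h3⟩ | ⟨rfl, rfl⟩)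
    · refine ⟨h1, ?_⟩
      have : Adj y x (cw N n b t P Q) ∨ (x < n ∧ Adj n x (cw N n b t P Q)) := by
        cases b <;> cases t <;> simp [cw, Adj_append, Adj_cons] at h2 ht ⊢ <;> grind
      rcases this with h | h
      · exact ⟨y, h, h3⟩
      · exact ⟨n, h.2, h.1⟩
    · refine ⟨hn, N, ?_, hn⟩
      cases t <;> simp [cw, Adj_append, Adj_cons]

theorem RR_cw {N n : ℕ} (hn : n < N) {b t : Bool} {P Q : List ℕ}
    (hP : ∀ x ∈ P, x < n ∨ x = N) (hQ : ∀ x ∈ Q, x < n ∨ x = N)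
    (ht : t = true → Q ≠ []) (hq : Q ≠ [] → ∃ q ∈ Q, q < n) (x : ℕ) :
    RR N (cw N n b t P Q) x ↔ RR N (P ++ N :: Q) x ∨ (x = n ∧ Q = []) := by
  constructor
  · rintro ⟨h1, h2, h3⟩
    by_cases hx : x = n
    · right
      refine ⟨hx, ?_⟩
      by_contra hQ'
      obtain ⟨q, hq1, hq2⟩ := hq hQ'
      have := h3 q (by cases b <;> cases t <;> simp [cw, S2_append, S2_cons, hx, hq1])
      omega
    · left
      refine ⟨h1, ?_, fun y hy => ?_⟩
      · cases b <;> cases t <;> simp [cw] at h2 ⊢ <;> grind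
      · have : S2 x y (cw N n b t P Q) ∨ y = N := by
          cases b <;> cases t <;> simp [cw, S2_append, S2_cons] at hy h2 ⊢ <;> grind
        rcases this with h | h
        · exact h3 y h
        · omega
  · rintro (⟨h1, h2, h3⟩ | ⟨rfl, rfl⟩)
    · have hx : x < n := by
        simp at h2
        rcases h2 with h | h | h
        · have := hP x h; omega
        · omega
        · have := hQ x h; omega
      refine ⟨h1, ?_, fun y hy => ?_⟩
      · cases b <;> cases t <;> simp [cw] at h2 ⊢ <;> grind
      · have : S2 x y (P ++ N :: Q) ∨ y = N ∨ y = n := by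
          cases b <;> cases t <;> simp [cw, S2_append, S2_cons] at hy h2 ⊢ <;> grind
        rcases this with h | h | h
        · exact h3 y h
        · omega
        · omega
    · have hxP : x ∉ P := fun h => by have := hP x h; omega
      have hs : ∀ y, ¬ S2 x y P := fun y h => hxP h.mem.1
      refine ⟨hn, ?_, fun y hy => ?_⟩
      · simp [cw]
      · simp at ht
        subst ht
        cases b <;> simp [cw, S2_append, S2_cons, S2_nil, hxP, hs] at hy <;> omega

abbrev Cfg := List (List ℕ)

def wd (N : ℕ) (c : Cfg) : List ℕ := c.flatMap (· ++ [N])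

inductive Child (n : ℕ) : Bool → Bool → ℕ → Cfg → Cfg → Prop
  | app (L : Cfg) (X : List ℕ) (R : Cfg) :
      Child n false false L.length (L ++ X :: R) (L ++ (X ++ [n]) :: R)
  | new (L : Cfg) (X : List ℕ) (R : Cfg) :
      Child n true false L.length (L ++ X :: R) (L ++ X :: [n] :: R)
  | join (L : Cfg) (X Y : List ℕ) (R : Cfg) :
      Child n false true L.length (L ++ X :: Y :: R) (L ++ (X ++ n :: Y) :: R)
  | prep (L : Cfg) (X Y : List ℕ) (R : Cfg) :
      Child n true true L.length (L ++ X :: Y :: R) (L ++ X :: (n :: Y) :: R)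

structure wf (n : ℕ) (c : Cfg) : Prop where
  ne : c ≠ []
  tl : ∀ X ∈ c.tail, X ≠ []
  pm : c.flatten.Perm (List.range n)

theorem wf.lt {n : ℕ} {c : Cfg} (h : wf n c) {X : List ℕ} (hX : X ∈ c) {x : ℕ} (hx : x ∈ X) :
    x < n := by
  have : x ∈ c.flatten := List.mem_flatten.2 ⟨X, hX, hx⟩
  simpa using h.pm.subset this

theorem wf.nodup {n : ℕ} {c : Cfg} (h : wf n c) : c.flatten.Nodup :=
  h.pm.nodup_iff.2 List.nodup_range

theorem wf.ne_of_mem_right {n : ℕ} {L R : Cfg} {X : List ℕ} (h : wf n (L ++ X :: R))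
    {Y : List ℕ} (hY : Y ∈ R) : Y ≠ [] := by
  apply h.tl
  cases L <;> simp [hY]

theorem perm_child {n : ℕ} {b t : Bool} {i : ℕ} {c c' : Cfg} (h : Child n b t i c c') :
    c'.flatten.Perm (n :: c.flatten) := by
  rw [List.perm_iff_count]
  intro a
  cases h <;> simp [List.count_cons] <;> omega

theorem wf_child {n : ℕ} {b t : Bool} {i : ℕ} {c c' : Cfg} (h : Child n b t i c c')
    (hc : wf n c) : wf (n + 1) c' := by
  have hp := perm_child h
  have h2 : (List.range (n + 1)).Perm (n :: List.range n) := by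
    rw [List.range_succ]; exact List.perm_append_singleton _ _
  refine ⟨by cases h <;> simp, ?_, (hp.trans ((List.perm_cons n).2 hc.pm)).trans h2.symm⟩
  have h3 := hc.tl
  clear hp h2 hc
  cases h with
  | app L X R =>
    cases L <;> simp at h3 ⊢
    · exact h3
    · rintro Y (h | h | h)
      · exact h3 _ (Or.inl h)
      · subst h; simp
      · exact h3 _ (Or.inr (Or.inr h))
  | new L X R =>
    cases L <;> simp at h3 ⊢
    · exact h3
    · rintro Y (h | h | h | h)
      · exact h3 _ (Or.inl h)
      · exact h3 _ (Or.inr (Or.inl h))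
      · subst h; simp
      · exact h3 _ (Or.inr (Or.inr h))
  | join L X Y R =>
    cases L <;> simp at h3 ⊢
    · exact h3.2
    · rintro Y (h | h | h)
      · exact h3 _ (Or.inl h)
      · subst h; simp
      · exact h3 _ (Or.inr (Or.inr (Or.inr h)))
  | prep L X Y R =>
    cases L <;> simp at h3 ⊢
    · exact h3.2
    · rintro Y (h | h | h | h)
      · exact h3 _ (Or.inl h)
      · exact h3 _ (Or.inr (Or.inl h))
      · subst h; simp
      · exact h3 _ (Or.inr (Or.inr (Or.inr h)))

theorem child_length {n : ℕ} {b t : Bool} {i : ℕ} {c c' : Cfg} (h : Child n b t i c c') :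
    c'.length + t.toNat = c.length + b.toNat ∧ i + t.toNat < c.length := by
  cases h <;> simp <;> omega

theorem child_dec {n : ℕ} (N : ℕ) {b t : Bool} {i : ℕ} {c c' : Cfg} (h : Child n b t i c c') :
    ∃ L X R, c = L ++ X :: R ∧ L.length = i ∧ (t = true → R ≠ []) ∧
      wd N c = (wd N L ++ X) ++ N :: wd N R ∧ wd N c' = cw N n b t (wd N L ++ X) (wd N R) := by
  cases h with
  | app L X R => exact ⟨L, X, R, rfl, rfl, by simp, by simp [wd], by simp [wd, cw]⟩
  | new L X R => exact ⟨L, X, R, rfl, rfl, by simp, by simp [wd], by simp [wd, cw]⟩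
  | join L X Y R => exact ⟨L, X, Y :: R, rfl, rfl, by simp, by simp [wd], by simp [wd, cw]⟩
  | prep L X Y R => exact ⟨L, X, Y :: R, rfl, rfl, by simp, by simp [wd], by simp [wd, cw]⟩

theorem mem_wd {N : ℕ} {c : Cfg} {x : ℕ} (h : x ∈ wd N c) : (∃ X ∈ c, x ∈ X) ∨ x = N := by
  simp [wd] at h
  grind

theorem mem_wd_of {N : ℕ} {c : Cfg} {x : ℕ} {X : List ℕ} (h : X ∈ c) (hx : x ∈ X) :
    x ∈ wd N c := by
  simp [wd]
  exact ⟨X, h, Or.inl hx⟩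

theorem wd_cons {N : ℕ} {c : Cfg} {X : List ℕ} : wd N (X :: c) = X ++ N :: wd N c := by simp [wd]
theorem wd_append {N : ℕ} {c d : Cfg} : wd N (c ++ d) = wd N c ++ wd N d := by simp [wd]
theorem wd_nil {N : ℕ} : wd N [] = [] := by simp [wd]

theorem getLast_wd {N n : ℕ} (hn : n < N) {L R : Cfg} {X : List ℕ} (h : wf n (L ++ X :: R)) :
    (wd N L ++ X).getLast? ≠ some N := by
  by_cases hX : X = []
  · have : L = [] := by
      by_contra hL
      cases L with
      | nil => exact hL rfl
      | cons a L => exact h.tl X (by simp) hX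
    subst this
    subst hX
    simp [wd]
  · rw [List.getLast?_append_of_ne_nil _ hX]
    intro h2
    have := h.lt (X := X) (by simp) (List.mem_of_getLast? h2)
    omega

theorem child_stats {n N : ℕ} (hn : n < N) {b t : Bool} {i : ℕ} {c c' : Cfg}
    (h : Child n b t i c c') (hc : wf n c) (x : ℕ) :
    (TT N (wd N c') x ↔ TT N (wd N c) x ∨ (x = n ∧ t = true)) ∧
    (BB N (wd N c') x ↔ BB N (wd N c) x ∨ (x = n ∧ b = true)) ∧
    (RR N (wd N c') x ↔ RR N (wd N c) x ∨ (x = n ∧ i + 1 = c.length)) := by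
  obtain ⟨L, X, R, rfl, rfl, ht, e1, e2⟩ := child_dec N h
  have hP : ∀ x ∈ wd N L ++ X, x < n ∨ x = N := by
    intro x hx
    rcases List.mem_append.1 hx with hx | hx
    · rcases mem_wd hx with ⟨Y, hY, hx⟩ | hx
      · exact Or.inl (hc.lt (X := Y) (by simp [hY]) hx)
      · exact Or.inr hx
    · exact Or.inl (hc.lt (X := X) (by simp) hx)
  have hQ : ∀ x ∈ wd N R, x < n ∨ x = N := by
    intro x hx
    rcases mem_wd hx with ⟨Y, hY, hx⟩ | hx
    · exact Or.inl (hc.lt (X := Y) (by simp [hY]) hx)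
    · exact Or.inr hx
  have hh : R ≠ [] → ∃ q, (wd N R).head? = some q ∧ q < n := by
    intro hR
    cases R with
    | nil => exact absurd rfl hR
    | cons Y R =>
      have hY := hc.ne_of_mem_right (Y := Y) (by simp)
      cases Y with
      | nil => exact absurd rfl hY
      | cons y Y => exact ⟨y, by simp [wd], hc.lt (X := y :: Y) (by simp) (by simp)⟩
  have hQR : wd N R = [] ↔ R = [] := by
    cases R <;> simp [wd]
  rw [e1, e2]
  refine ⟨TT_cw hn hP hQ (fun h => hh (ht h)) x,
    BB_cw hn hP hQ (fun h => hh (ht h)) (getLast_wd hn hc) x, ?_⟩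
  rw [RR_cw hn hP hQ (fun h => mt hQR.1 (ht h)) ?_ x, hQR]
  · simp
  · intro hQ
    obtain ⟨q, h1, h2⟩ := hh (mt hQR.2 hQ)
    exact ⟨q, List.mem_of_mem_head? h1, h2⟩

def gt (X Y : List ℕ) : Prop := ∀ x ∈ X, ∀ y ∈ Y, y ≤ x
def gtAll (R : Cfg) (X : List ℕ) : Prop := ∀ Y ∈ R, gt X Y
def alA (c : Cfg) (i : ℕ) : Prop := (c.drop (i + 1)).Pairwise gt
def alB (c : Cfg) (i : ℕ) : Prop := ∀ X ∈ (c.take (i + 1)).tail, gtAll (c.drop (i + 1)) X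
noncomputable def ee (c : Cfg) (i : ℕ) : ℕ :=
  (c.take (i + 1)).tail.countP (fun X => decide (gtAll (c.drop (i + 1)) X))

theorem linkA {N : ℕ} {R : Cfg} (hR : ∀ X ∈ R, ∀ x ∈ X, x < N) :
    (∃ x y, S3 x N y (wd N R) ∧ x < y ∧ y < N) ↔ ¬ R.Pairwise gt := by
  induction R with
  | nil => simp [wd_nil, S3_nil]
  | cons Y R ih =>
    have h1 : ∀ x ∈ Y, x < N := hR Y (by simp)
    have h2 : ∀ X ∈ R, ∀ x ∈ X, x < N := fun X hX => hR X (by simp [hX])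
    have hN : N ∉ Y := fun h => lt_irrefl _ (h1 N h)
    have key : ∀ x y, x < y → y < N →
        (S3 x N y (wd N (Y :: R)) ↔ S3 x N y (wd N R) ∨ (x ∈ Y ∧ y ∈ wd N R)) := by
      intro x y hxy hy
      rw [wd_cons, S3_append, S3_cons]
      constructor
      · rintro (h | ⟨h, h'⟩ | ⟨h, h'⟩ | h)
        · exact absurd h.mem.2.1 hN
        · exact absurd h.mem.2 hN
        · rw [S2_cons] at h'
          rcases h' with h' | h'
          · exact Or.inr ⟨h, h'.2⟩
          · exact Or.inr ⟨h, h'.mem.2⟩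
        · rcases h with ⟨h, _⟩ | h
          · omega
          · exact Or.inl h
      · rintro (h | ⟨h, h'⟩)
        · exact Or.inr (Or.inr (Or.inr (Or.inr h)))
        · refine Or.inr (Or.inr (Or.inl ⟨h, ?_⟩))
          rw [S2_cons]
          exact Or.inl ⟨rfl, h'⟩
    rw [List.pairwise_cons, not_and_or, ← ih h2]
    constructor
    · rintro ⟨x, y, h, hxy, hy⟩
      rw [key x y hxy hy] at h
      rcases h with h | ⟨h, h'⟩
      · exact Or.inr ⟨x, y, h, hxy, hy⟩
      · left
        intro h3
        rcases mem_wd h' with ⟨Z, hZ, hz⟩ | h'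
        · have := h3 Z hZ x h y hz
          omega
        · omega
    · rintro (h | ⟨x, y, h, hxy, hy⟩)
      · simp only [gt] at h
        push Not at h
        obtain ⟨Z, hZ, x, hx, y, hy, hxy⟩ := h
        exact ⟨x, y, (key x y hxy (h2 Z hZ y hy)).2 (Or.inr ⟨hx, mem_wd_of hZ hy⟩), hxy, h2 Z hZ y hy⟩
      · exact ⟨x, y, (key x y hxy hy).2 (Or.inl h), hxy, hy⟩

theorem S2_wd {N x : ℕ} (hx : x < N) {L : Cfg} {X : List ℕ} (hL : ∀ Y ∈ L ++ [X], N ∉ Y) :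
    S2 N x (wd N L ++ X) ↔ ∃ X' ∈ (L ++ [X]).tail, x ∈ X' := by
  cases L with
  | nil =>
    simp [wd_nil]
    intro h
    exact hL X (by simp) h.mem.1
  | cons Y L =>
    have hY : N ∉ Y := hL Y (by simp)
    have : S2 N x (wd N (Y :: L) ++ X) ↔ x ∈ wd N L ++ X := by
      rw [wd_cons, List.append_assoc, S2_append, List.cons_append, S2_cons]
      constructor
      · rintro (h | h | h)
        · exact absurd h.mem.1 hY
        · exact absurd h.1 hY
        · rcases h with h | h
          · exact h.2
          · exact h.mem.2
      · intro h
        exact Or.inr (Or.inr (Or.inl ⟨rfl, h⟩))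
    rw [this]
    simp only [List.cons_append, List.tail_cons, List.mem_append]
    constructor
    · rintro (h | h)
      · rcases mem_wd h with ⟨Z, hZ, hz⟩ | h
        · exact ⟨Z, Or.inl hZ, hz⟩
        · omega
      · exact ⟨X, by simp, h⟩
    · rintro ⟨Z, hZ | hZ, hz⟩
      · exact Or.inl (mem_wd_of hZ hz)
      · simp at hZ; subst hZ; exact Or.inr hz

theorem child_CA {n N : ℕ} (hn : n < N) {b t : Bool} {i : ℕ} {c c' : Cfg}
    (h : Child n b t i c c') (hc : wf n c) :
    (CA (wd N c') ↔ CA (wd N c) ∨ ¬ alA c i) ∧ (CB (wd N c') ↔ CB (wd N c) ∨ ¬ alB c i) := by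
  obtain ⟨L, X, R, rfl, rfl, ht, e1, e2⟩ := child_dec N h
  have hP : ∀ x ∈ wd N L ++ X, x < n ∨ x = N := by
    intro x hx
    rcases List.mem_append.1 hx with hx | hx
    · rcases mem_wd hx with ⟨Y, hY, hx⟩ | hx
      · exact Or.inl (hc.lt (X := Y) (by simp [hY]) hx)
      · exact Or.inr hx
    · exact Or.inl (hc.lt (X := X) (by simp) hx)
  have hQ : ∀ x ∈ wd N R, x < n ∨ x = N := by
    intro x hx
    rcases mem_wd hx with ⟨Y, hY, hx⟩ | hx
    · exact Or.inl (hc.lt (X := Y) (by simp [hY]) hx)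
    · exact Or.inr hx
  have hR : ∀ X ∈ R, ∀ x ∈ X, x < N := fun Y hY x hx =>
    (hc.lt (X := Y) (by simp [hY]) hx).trans hn
  have hL : ∀ Y ∈ L ++ [X], N ∉ Y := by
    intro Y hY h
    have := hc.lt (X := Y) (by simp at hY ⊢; tauto) h
    omega
  have d1 : (L ++ X :: R).drop (L.length + 1) = R := by
    rw [List.drop_append]; simp
  have d2 : (L ++ X :: R).take (L.length + 1) = L ++ [X] := by
    rw [List.take_append]; simp
  rw [e1, e2, CA_cw hn hP hQ, CB_cw hn hP hQ, linkA hR, alA, alB, d1, d2]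
  refine ⟨Iff.rfl, or_congr Iff.rfl ?_⟩
  simp only [gtAll, gt]
  push Not
  constructor
  · rintro ⟨x, y, h, hy, hxy, hyN⟩
    obtain ⟨X', h1, h2⟩ := (S2_wd (hxy.trans hyN) hL).1 h
    rcases mem_wd hy with ⟨Z, hZ, hz⟩ | h'
    · exact ⟨X', h1, Z, hZ, x, h2, y, hz, hxy⟩
    · omega
  · rintro ⟨X', h1, Z, hZ, x, h2, y, hz, hxy⟩
    have := hR Z hZ y hz
    exact ⟨x, y, (S2_wd (hxy.trans this) hL).2 ⟨X', h1, h2⟩, mem_wd_of hZ hz, hxy, this⟩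

def LA (c : Cfg) (x : ℕ) : Prop := ∃ U R, U ≠ [] ∧ c = U ++ R ∧ R.Pairwise gt ∧
  U.tail.countP (fun X => decide (gtAll R X)) = x
def LB (c : Cfg) (x : ℕ) : Prop := ∃ U R, U.length = x + 1 ∧ c = U ++ R ∧
  ∀ X ∈ U.tail, gtAll R X

theorem gtAll_nil {R : Cfg} : gtAll R [] := by simp [gtAll, gt]
theorem gtAll_app {R : Cfg} {X Y : List ℕ} : gtAll R (X ++ Y) ↔ gtAll R X ∧ gtAll R Y := by
  simp only [gtAll, gt, List.mem_append]
  grind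
theorem gtAll_single {R : Cfg} {n : ℕ} (h : ∀ Y ∈ R, ∀ y ∈ Y, y < n) : gtAll R [n] := by
  intro Y hY x hx y hy
  simp at hx
  have := h Y hY y hy
  omega

theorem child_str {n : ℕ} {b t : Bool} {i : ℕ} {c c' : Cfg} (h : Child n b t i c c') :
    ∃ U W R' L' Z, c = (U ++ W) ++ R' ∧ c' = (L' ++ [Z]) ++ R' ∧ n ∈ Z ∧
      L'.length = i + b.toNat ∧ U.length = i + 1 ∧ W.length = t.toNat ∧
      (∀ R2 : Cfg, (∀ Y ∈ R2, ∀ y ∈ Y, y < n) → (∀ Y ∈ W, gtAll R2 Y) →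
        (L' ++ [Z]).tail.countP (fun X => decide (gtAll R2 X)) + t.toNat =
        (U ++ W).tail.countP (fun X => decide (gtAll R2 X)) + b.toNat) ∧
      (∀ R2 : Cfg, (∀ X ∈ (L' ++ [Z]).tail, gtAll R2 X) → (∀ Y ∈ W, gtAll R2 Y) ∨
        (U.length = 1 ∧ b = false)) := by
  cases h with
  | app L X R =>
    refine ⟨L ++ [X], [], R, L, X ++ [n], by simp, by simp, by simp, by simp, by simp, by simp,
      ?_, by simp⟩
    intro R2 hR2 _
    cases L <;> simp [List.countP_cons, gtAll_app, gtAll_single hR2]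
  | new L X R =>
    refine ⟨L ++ [X], [], R, L ++ [X], [n], by simp, by simp, by simp, by simp, by simp, by simp,
      ?_, by simp⟩
    intro R2 hR2 _
    cases L <;> simp [List.countP_cons, gtAll_app, gtAll_single hR2]
    omega
  | join L X Y R =>
    refine ⟨L ++ [X], [Y], R, L, X ++ n :: Y, by simp, by simp, by simp, by simp, by simp, by simp,
      ?_, ?_⟩
    · intro R2 hR2 hY
      have hY : gtAll R2 Y := hY Y (by simp)
      have h3 : gtAll R2 (n :: Y) := by
        rw [← List.singleton_append, gtAll_app]; exact ⟨gtAll_single hR2, hY⟩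
      cases L <;> simp [List.countP_cons, gtAll_app, h3, hY]
      omega
    · intro R2 h
      cases L with
      | nil => simp
      | cons A L =>
        left
        have := h (X ++ n :: Y) (by simp)
        rw [gtAll_app, ← List.singleton_append, gtAll_app] at this
        simpa using this.2.2
  | prep L X Y R =>
    refine ⟨L ++ [X], [Y], R, L ++ [X], n :: Y, by simp, by simp, by simp, by simp, by simp, by simp,
      ?_, ?_⟩
    · intro R2 hR2 hY
      have hY : gtAll R2 Y := hY Y (by simp)
      have h3 : gtAll R2 (n :: Y) := by
        rw [← List.singleton_append, gtAll_app]; exact ⟨gtAll_single hR2, hY⟩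
      cases L <;> simp [List.countP_cons, h3, hY]
    · intro R2 h
      left
      have := h (n :: Y) (by cases L <;> simp)
      rw [← List.singleton_append, gtAll_app] at this
      simpa using this.2

theorem countP_tail_append (p : List ℕ → Bool) {U S : Cfg} (hU : U ≠ []) :
    (U ++ S).tail.countP p = U.tail.countP p + S.countP p := by
  rw [List.tail_append_of_ne_nil hU, List.countP_append]

/-- Strict monotonicity of the labels. -/
theorem mono_e {U S R : Cfg} (hU : U ≠ []) (h : (S ++ R).Pairwise gt) :
    U.tail.countP (fun X => decide (gtAll (S ++ R) X)) + S.length ≤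
      (U ++ S).tail.countP (fun X => decide (gtAll R X)) := by
  rw [countP_tail_append _ hU]
  have h1 : S.countP (fun X => decide (gtAll R X)) = S.length := by
    rw [List.countP_eq_length]
    intro X hX
    rw [decide_eq_true_iff]
    intro Y hY
    exact (List.pairwise_append.1 h).2.2 X hX Y hY
  rw [h1]
  gcongr
  apply List.countP_mono_left
  intro X _ h
  rw [decide_eq_true_iff] at h ⊢
  intro Y hY
  exact h Y (by simp [hY])

theorem zeroA {n N : ℕ} (hn : n ≤ N) {c : Cfg} (hc : wf n c) (hA : ¬ CA (wd N c)) : LA c 0 := by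
  have dec : ∀ c : Cfg, c ≠ [] → ∃ L X R, c = L ++ X :: R ∧ R.Pairwise gt ∧
      (L = [] ∨ ¬ (X :: R).Pairwise gt) := by
    intro c
    induction c with
    | nil => simp
    | cons A c ih =>
      intro _
      by_cases hp : c.Pairwise gt
      · exact ⟨[], A, c, rfl, hp, Or.inl rfl⟩
      · have : c ≠ [] := by rintro rfl; simp at hp
        obtain ⟨L, X, R, rfl, h2, h3⟩ := ih this
        refine ⟨A :: L, X, R, rfl, h2, Or.inr ?_⟩
        rcases h3 with rfl | h3
        · simpa using hp
        · exact h3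
  obtain ⟨L, X, R, rfl, h2, h3⟩ := dec c hc.ne
  refine ⟨L ++ [X], R, by simp, by simp, h2, ?_⟩
  rcases h3 with rfl | h3
  · simp
  rw [List.countP_eq_zero]
  intro X' hX'
  rw [decide_eq_true_iff]
  intro hg
  rw [List.pairwise_cons, not_and_or] at h3
  have h3 := h3.resolve_right (by simpa using h2)
  simp only [gt] at h3
  push Not at h3
  obtain ⟨Y, hY, x, hx, y, hy, hxy⟩ := h3
  have hne : X' ≠ [] := by
    apply hc.tl
    cases L with
    | nil => simp at hX'
    | cons A L => simp at hX' ⊢; tauto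
  obtain ⟨z, hz⟩ := List.exists_mem_of_ne_nil _ hne
  have hzy := hg Y hY z hz y hy
  have hyn : z < n := by
    refine hc.lt (X := X') ?_ hz
    have := List.mem_of_mem_tail hX'
    simp at this ⊢; tauto
  -- X' ≠ X
  have hX'L : X' ∈ L := by
    have := List.mem_of_mem_tail hX'
    simp at this
    rcases this with h | rfl
    · exact h
    · have := hg Y hY x hx y hy
      omega
  have hne2 : y ≠ z := by
    rintro rfl
    have hnd := hc.nodup
    rw [List.flatten_append, List.nodup_append] at hnd
    exact hnd.2.2 y (List.mem_flatten.2 ⟨X', hX'L, hz⟩) y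
      (List.mem_flatten.2 ⟨Y, by simp [hY], hy⟩) rfl
  apply hA
  refine ⟨z, x, N, y, ?_, hxy, by omega, by omega⟩
  rw [wd_append, wd_cons, S4_append]
  right; right; right; left
  refine ⟨mem_wd_of hX'L hz, ?_⟩
  rw [S3_append]
  right; right; left
  refine ⟨hx, ?_⟩
  rw [S2_cons]
  exact Or.inl ⟨rfl, mem_wd_of hY hy⟩

theorem alA_split {U R : Cfg} {i : ℕ} (h : U.length = i + 1) : alA (U ++ R) i ↔ R.Pairwise gt := by
  rw [alA, ← h, List.drop_left]
theorem alB_split {U R : Cfg} {i : ℕ} (h : U.length = i + 1) :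
    alB (U ++ R) i ↔ ∀ X ∈ U.tail, gtAll R X := by
  rw [alB, ← h, List.drop_left, List.take_left]
theorem ee_split {U R : Cfg} {i : ℕ} (h : U.length = i + 1) :
    ee (U ++ R) i = U.tail.countP (fun X => decide (gtAll R X)) := by
  rw [ee, ← h, List.drop_left, List.take_left]

/-- If `n` occurs on the right, no nonempty block dominates. -/
theorem not_gtAll {n : ℕ} {R : Cfg} {X Z : List ℕ} (hZ : Z ∈ R) (hn : n ∈ Z) (hX : ∃ x ∈ X, x < n) :
    ¬ gtAll R X := by
  obtain ⟨x, hx, h⟩ := hX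
  intro h2
  have := h2 Z hZ x hx n hn
  omega

/-- Splits of the child. -/
theorem split_child {U' R' U2 R2 L' : Cfg} {Z : List ℕ} (hU : U' = L' ++ [Z])
    (h : U' ++ R' = U2 ++ R2) :
    (∃ S, U2 = U' ++ S ∧ R' = S ++ R2) ∨
      (∃ S, L' = U2 ++ S ∧ R2 = S ++ Z :: R') := by
  rcases List.append_eq_append_iff.1 h with ⟨S, h1, h2⟩ | ⟨S, h1, h2⟩
  · exact Or.inl ⟨S, h1, h2⟩
  · rcases List.eq_nil_or_concat S with rfl | ⟨S', s, rfl⟩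
    · left; exact ⟨[], by simp at h1; simp [h1], by simpa using h2.symm⟩
    · right
      refine ⟨S', ?_⟩
      rw [hU, List.concat_eq_append] at h1
      rw [← List.append_assoc] at h1
      obtain ⟨h3, h4⟩ := List.append_inj' h1 rfl
      simp at h4
      subst h4
      exact ⟨h3, by simp [h2]⟩

theorem small_split {n : ℕ} {b t : Bool} {i : ℕ} {c c' : Cfg} (h : Child n b t i c c')
    (hc : wf n c) {L' U2 S R' : Cfg} {Z : List ℕ} (hU2 : U2 ≠ [])
    (e : c' = (L' ++ [Z]) ++ R') (hn : n ∈ Z) (e2 : L' = U2 ++ S) :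
    ∀ X ∈ U2.tail, ¬ gtAll (S ++ Z :: R') X := by
  intro X hX
  have hc' := wf_child h hc
  apply not_gtAll (n := n) (Z := Z) (by simp) hn
  have hXc : X ∈ c'.tail := by
    rw [e, e2]
    cases U2 with
    | nil => exact absurd rfl hU2
    | cons A U2 => simp at hX ⊢; tauto
  obtain ⟨x, hx⟩ := List.exists_mem_of_ne_nil _ (hc'.tl X hXc)
  refine ⟨x, hx, ?_⟩
  have h1 := hc'.lt (List.mem_of_mem_tail hXc) hx
  have h2 : x ≠ n := by
    rintro rfl
    have := hc'.nodup
    rw [e, List.append_assoc, List.flatten_append, List.nodup_append] at this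
    refine this.2.2 x (List.mem_flatten.2 ⟨X, ?_, hx⟩) x (List.mem_flatten.2 ⟨Z, by simp, hn⟩) rfl
    rw [e2]
    exact List.mem_append_left _ (List.mem_of_mem_tail hX)
  omega

theorem LA_step {n N : ℕ} (hnN : n < N) {b t : Bool} {i : ℕ} {c c' : Cfg} (h : Child n b t i c c')
    (hc : wf n c) (hA : ¬ CA (wd N c')) (hal : alA c i) (x' : ℕ) :
    LA c' x' ↔ x' = 0 ∨ ∃ x, LA c x ∧ ee c i + t.toNat ≤ x ∧ x' + t.toNat = x + b.toNat := by
  obtain ⟨U, W, R', L', Z, e1, e2, hnZ, l1, l2, l3, hcnt, -⟩ := child_str h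
  have hU : U ≠ [] := by rintro rfl; simp at l2
  have hal' : (W ++ R').Pairwise gt := by
    rwa [e1, List.append_assoc, alA_split l2] at hal
  have hee : ee c i = U.tail.countP (fun X => decide (gtAll (W ++ R') X)) := by
    rw [e1, List.append_assoc, ee_split l2]
  have hlt : ∀ Y ∈ R', ∀ y ∈ Y, y < n := fun Y hY y hy => hc.lt (X := Y) (by simp [e1, hY]) hy
  have hU' : L' ++ [Z] ≠ [] := by simp
  have hW : ∀ S R2, R' = S ++ R2 → ∀ Y ∈ W, gtAll R2 Y := by
    intro S R2 hS Y hY Y2 hY2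
    exact (List.pairwise_append.1 hal').2.2 Y hY Y2 (by simp [hS, hY2])
  have key : ∀ S R2, R' = S ++ R2 →
      ((L' ++ [Z]) ++ S).tail.countP (fun X => decide (gtAll R2 X)) + t.toNat =
      ((U ++ W) ++ S).tail.countP (fun X => decide (gtAll R2 X)) + b.toNat := by
    intro S R2 hS
    have := hcnt R2 (fun Y hY => hlt Y (by simp [hS, hY])) (hW S R2 hS)
    rw [countP_tail_append _ hU', countP_tail_append (U := U ++ W) _ (by simp [hU])]
    omega
  have key2 : ∀ S R2, R' = S ++ R2 → ee c i + t.toNat ≤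
      ((U ++ W) ++ S).tail.countP (fun X => decide (gtAll R2 X)) := by
    intro S R2 hS
    have := mono_e (U := U) (S := W ++ S) (R := R2) hU (by rw [hS] at hal'; simpa using hal')
    rw [hee, hS]
    simp only [List.append_assoc, List.length_append] at this ⊢
    omega
  constructor
  · rintro ⟨U2, R2, hU2, e3, hp, rfl⟩
    rcases split_child rfl (e2.symm.trans e3) with ⟨S, rfl, hS⟩ | ⟨S, h1, h2⟩
    · right
      refine ⟨_, ⟨U ++ W ++ S, R2, by simp [hU], by simp [e1, hS], hp, rfl⟩, key2 S R2 hS, key S R2 hS⟩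
    · left
      rw [List.countP_eq_zero]
      intro X hX
      rw [decide_eq_true_iff, h2]
      exact small_split h hc hU2 e2 hnZ h1 X hX
  · rintro (rfl | ⟨x, ⟨U2, R2, hU2, e3, hp, rfl⟩, hle, hx⟩)
    · exact zeroA (n := n + 1) hnN (wf_child h hc) hA
    · have : ∃ S, U2 = (U ++ W) ++ S ∧ R' = S ++ R2 := by
        rcases List.append_eq_append_iff.1 (e1.symm.trans e3) with h4 | ⟨S, h1, h2⟩
        · exact h4
        · by_cases hS : S = []
          · subst hS
            exact ⟨[], by simpa using h1.symm, by simpa using h2.symm⟩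
          exfalso
          rcases List.append_eq_append_iff.1 h1 with ⟨S2, h5, h6⟩ | ⟨S2, h5, h6⟩
          · -- U2 = U ++ S2, W = S2 ++ S
            have hl := congrArg List.length h6
            simp only [List.length_append] at hl
            have hSl : 0 < S.length := List.length_pos_iff.2 hS
            have ht1 : t.toNat ≤ 1 := by cases t <;> simp
            have : S2 = [] := List.eq_nil_of_length_eq_zero (by omega)
            subst this
            simp at h5 h6
            subst h5 h6
            rw [h2, ← hee] at hle
            omega
          · have := mono_e (U := U2) (S := S2) (R := W ++ R') hU2 (by rw [h2, h6] at hp; simpa using hp)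
            rw [← h5, ← hee, ← List.append_assoc, ← h6, ← h2] at this
            have hl := congrArg List.length h6
            simp only [List.length_append] at hl
            have hSl : 0 < S.length := List.length_pos_iff.2 hS
            omega
      obtain ⟨S, rfl, hS⟩ := this
      refine ⟨L' ++ [Z] ++ S, R2, by simp, by simp [e2, hS], hp, ?_⟩
      have := key S R2 hS
      omega

theorem all_iff_countP {R : Cfg} {U : Cfg} : (∀ X ∈ U, gtAll R X) ↔
    U.countP (fun X => decide (gtAll R X)) = U.length := by
  rw [List.countP_eq_length]
  simp

theorem LB_step {n N : ℕ} (hnN : n < N) {b t : Bool} {i : ℕ} {c c' : Cfg} (h : Child n b t i c c')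
    (hc : wf n c) (hB : ¬ CB (wd N c)) (x' : ℕ) :
    LB c' x' ↔ x' = 0 ∨ ∃ x, LB c x ∧ i + t.toNat ≤ x ∧ x' + t.toNat = x + b.toNat := by
  obtain ⟨U, W, R', L', Z, e1, e2, hnZ, l1, l2, l3, hcnt, hor⟩ := child_str h
  have hU : U ≠ [] := by rintro rfl; simp at l2
  have hlt : ∀ Y ∈ R', ∀ y ∈ Y, y < n := fun Y hY y hy => hc.lt (X := Y) (by simp [e1, hY]) hy
  have hU' : L' ++ [Z] ≠ [] := by simp
  have key : ∀ S R2, R' = S ++ R2 → (∀ Y ∈ W, gtAll R2 Y) →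
      ((∀ X ∈ ((L' ++ [Z]) ++ S).tail, gtAll R2 X) ↔
      (∀ X ∈ ((U ++ W) ++ S).tail, gtAll R2 X)) := by
    intro S R2 hS hW
    have := hcnt R2 (fun Y hY => hlt Y (by simp [hS, hY])) hW
    rw [all_iff_countP, all_iff_countP,
      countP_tail_append _ hU', countP_tail_append (U := U ++ W) _ (by simp [hU])]
    simp only [List.length_tail, List.length_append, List.length_singleton]
    omega
  constructor
  · rintro ⟨U2, R2, hU2, e3, hp⟩
    rcases split_child rfl (e2.symm.trans e3) with ⟨S, rfl, hS⟩ | ⟨S, h1, h2⟩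
    · by_cases hx0 : x' = 0
      · exact Or.inl hx0
      right
      have hW : ∀ Y ∈ W, gtAll R2 Y := by
        rcases hor R2 (fun X hX => hp X (by
          rw [List.tail_append_of_ne_nil hU']; exact List.mem_append_left _ hX)) with h5 | h5
        · exact h5
        · intro Y hY Z2 hZ2 y hy z hz
          by_contra hyz
          push Not at hyz
          have hSne : S ≠ [] := by
            rintro rfl
            have hb := h5.2
            subst hb
            simp at hU2 l1
            omega
          obtain ⟨S1, hS1⟩ := List.exists_mem_of_ne_nil _ hSne
          have hS1ne : S1 ≠ [] := by
            apply hc.tl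
            rw [e1, List.append_assoc, List.tail_append_of_ne_nil hU]
            simp [hS, hS1]
          obtain ⟨s, hs⟩ := List.exists_mem_of_ne_nil _ hS1ne
          have hzs : z ≤ s := hp S1 (by
            rw [List.tail_append_of_ne_nil hU']; simp [hS1]) Z2 hZ2 s hs z hz
          have hsN : s < n := hlt S1 (by simp [hS, hS1]) s hs
          have hne : s ≠ z := by
            rintro rfl
            have hnd := hc.nodup
            rw [e1, hS, ← List.append_assoc, List.flatten_append, List.nodup_append] at hnd
            exact hnd.2.2 s (List.mem_flatten.2 ⟨S1, by simp [hS1], hs⟩) s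
              (List.mem_flatten.2 ⟨Z2, hZ2, hz⟩) rfl
          apply hB
          refine ⟨N, y, s, z, ?_, hyz, by omega, by omega⟩
          rw [e1, hS, List.append_assoc, wd_append, wd_append, wd_append, S4_append]
          right; right; right; left
          constructor
          · cases U with
            | nil => exact absurd rfl hU
            | cons A U => simp [wd]
          rw [S3_append]
          right; right; left
          refine ⟨mem_wd_of hY hy, ?_⟩
          rw [S2_append]
          exact Or.inr (Or.inl ⟨mem_wd_of hS1 hs, mem_wd_of hZ2 hz⟩)
      refine ⟨x' + t.toNat - b.toNat, ⟨U ++ W ++ S, R2, ?_, by simp [e1, hS], (key S R2 hS hW).1 hp⟩, ?_, ?_⟩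
      all_goals
        simp only [List.length_append, List.length_singleton] at hU2 ⊢
        omega
    · left
      by_contra hx0
      have hne : U2.tail ≠ [] := by
        intro h6
        have := congrArg List.length h6
        simp at this
        omega
      obtain ⟨X, hX⟩ := List.exists_mem_of_ne_nil _ hne
      have := hp X hX
      rw [h2] at this
      exact small_split h hc (by rintro rfl; simp at hU2) e2 hnZ h1 X hX this
  · rintro (rfl | ⟨x, ⟨U2, R2, hU2, e3, hp⟩, hle, hx⟩)
    · have := (wf_child h hc).ne
      cases c' with
      | nil => exact absurd rfl this
      | cons A c' => exact ⟨[A], c', rfl, rfl, by simp⟩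
    · have : ∃ S, U2 = (U ++ W) ++ S ∧ R' = S ++ R2 := by
        rcases List.append_eq_append_iff.1 (e1.symm.trans e3) with h4 | ⟨S, h1, h2⟩
        · exact h4
        · have hl := congrArg List.length h1
          simp only [List.length_append] at hl
          have : S = [] := List.eq_nil_of_length_eq_zero (by omega)
          subst this
          exact ⟨[], by simpa using h1.symm, by simpa using h2.symm⟩
      obtain ⟨S, rfl, hS⟩ := this
      refine ⟨L' ++ [Z] ++ S, R2, ?_, by simp [e2, hS], (key S R2 hS ?_).2 hp⟩
      · simp only [List.length_append, List.length_singleton] at hU2 ⊢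
        omega
      · intro Y hY
        apply hp
        rw [List.append_assoc, List.tail_append_of_ne_nil hU]
        simp [hY]

theorem inv_app {n i : ℕ} {c c' : Cfg} (h : Child n false false i c c') :
    ∃ L X R, i = L.length ∧ c = L ++ X :: R ∧ c' = L ++ (X ++ [n]) :: R := by
  cases h with | app L X R => exact ⟨L, X, R, rfl, rfl, rfl⟩
theorem inv_new {n i : ℕ} {c c' : Cfg} (h : Child n true false i c c') :
    ∃ L X R, i = L.length ∧ c = L ++ X :: R ∧ c' = L ++ X :: [n] :: R := by
  cases h with | new L X R => exact ⟨L, X, R, rfl, rfl, rfl⟩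
theorem inv_join {n i : ℕ} {c c' : Cfg} (h : Child n false true i c c') :
    ∃ L X Y R, i = L.length ∧ c = L ++ X :: Y :: R ∧ c' = L ++ (X ++ n :: Y) :: R := by
  cases h with | join L X Y R => exact ⟨L, X, Y, R, rfl, rfl, rfl⟩
theorem inv_prep {n i : ℕ} {c c' : Cfg} (h : Child n true true i c c') :
    ∃ L X Y R, i = L.length ∧ c = L ++ X :: Y :: R ∧ c' = L ++ X :: (n :: Y) :: R := by
  cases h with | prep L X Y R => exact ⟨L, X, Y, R, rfl, rfl, rfl⟩

theorem mid_inj {n : ℕ} {L1 L2 R1 R2 : Cfg} {Z1 Z2 : List ℕ} (h : L1 ++ Z1 :: R1 = L2 ++ Z2 :: R2)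
    (h1 : n ∈ Z1) (h2 : n ∈ Z2) (h3 : ∀ X ∈ L1, n ∉ X) (h4 : ∀ X ∈ L2, n ∉ X) :
    L1 = L2 ∧ Z1 = Z2 ∧ R1 = R2 := by
  induction L1 generalizing L2 with
  | nil =>
    cases L2 with
    | nil => simpa using h
    | cons A L2 =>
      simp at h
      exact absurd (h.1 ▸ h1) (h4 A (by simp))
  | cons A L1 ih =>
    cases L2 with
    | nil =>
      simp at h
      exact absurd (h.1 ▸ h2) (h3 A (by simp))
    | cons B L2 =>
      simp at h
      have := ih h.2 (fun X hX => h3 X (by simp [hX])) (fun X hX => h4 X (by simp [hX]))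
      simp [h.1, this]

theorem child_fun {n : ℕ} {b t : Bool} {i : ℕ} {c c1 c2 : Cfg} (h1 : Child n b t i c c1)
    (h2 : Child n b t i c c2) : c1 = c2 := by
  cases b <;> cases t
  · obtain ⟨L, X, R, hi, rfl, rfl⟩ := inv_app h1
    obtain ⟨L2, X2, R2, hi2, e, rfl⟩ := inv_app h2
    obtain ⟨h3, h4⟩ := List.append_inj e (hi.symm.trans hi2)
    simp_all
  · obtain ⟨L, X, Y, R, hi, rfl, rfl⟩ := inv_join h1
    obtain ⟨L2, X2, Y2, R2, hi2, e, rfl⟩ := inv_join h2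
    obtain ⟨h3, h4⟩ := List.append_inj e (hi.symm.trans hi2)
    simp_all
  · obtain ⟨L, X, R, hi, rfl, rfl⟩ := inv_new h1
    obtain ⟨L2, X2, R2, hi2, e, rfl⟩ := inv_new h2
    obtain ⟨h3, h4⟩ := List.append_inj e (hi.symm.trans hi2)
    simp_all
  · obtain ⟨L, X, Y, R, hi, rfl, rfl⟩ := inv_prep h1
    obtain ⟨L2, X2, Y2, R2, hi2, e, rfl⟩ := inv_prep h2
    obtain ⟨h3, h4⟩ := List.append_inj e (hi.symm.trans hi2)
    simp_all

theorem wf.fresh {n : ℕ} {c : Cfg} (h : wf n c) {X : List ℕ} (hX : X ∈ c) : n ∉ X :=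
  fun hx => lt_irrefl _ (h.lt hX hx)

theorem child_inj {n : ℕ} {b t : Bool} {i1 i2 : ℕ} {c' c1 c2 : Cfg} (h1 : Child n b t i1 c1 c')
    (h2 : Child n b t i2 c2 c') (w1 : wf n c1) (w2 : wf n c2) : i1 = i2 ∧ c1 = c2 := by
  cases b <;> cases t
  · obtain ⟨L, X, R, hi, rfl, rfl⟩ := inv_app h1
    obtain ⟨L2, X2, R2, hi2, rfl, e⟩ := inv_app h2
    obtain ⟨h3, h4, h5⟩ := mid_inj (n := n) e (by simp) (by simp)
      (fun X hX => w1.fresh (by simp [hX])) (fun X hX => w2.fresh (by simp [hX]))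
    simp_all
  · obtain ⟨L, X, Y, R, hi, rfl, rfl⟩ := inv_join h1
    obtain ⟨L2, X2, Y2, R2, hi2, rfl, e⟩ := inv_join h2
    obtain ⟨h3, h4, h5⟩ := mid_inj (n := n) e (by simp) (by simp)
      (fun X hX => w1.fresh (by simp [hX])) (fun X hX => w2.fresh (by simp [hX]))
    have f1 : n ∉ X := w1.fresh (by simp)
    have f2 : n ∉ X2 := w2.fresh (by simp)
    have f3 : n ∉ Y := w1.fresh (by simp)
    have f4 : n ∉ Y2 := w2.fresh (by simp)
    have := List.append_cons_inj_of_notMem (x₁ := X) (x₂ := X2) (z₁ := Y) (z₂ := Y2) (a₁ := n) (a₂ := n) 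
      (by assumption) (by assumption) |>.1 h4
    simp_all
  · obtain ⟨L, X, R, hi, rfl, rfl⟩ := inv_new h1
    obtain ⟨L2, X2, R2, hi2, rfl, e⟩ := inv_new h2
    have e' : (L ++ [X]) ++ [n] :: R = (L2 ++ [X2]) ++ [n] :: R2 := by simpa using e
    obtain ⟨h3, h4, h5⟩ := mid_inj (n := n) e' (by simp) (by simp)
      (fun X hX => w1.fresh (by simp at hX ⊢; tauto)) (fun X hX => w2.fresh (by simp at hX ⊢; tauto))
    obtain ⟨h6, h7⟩ := List.append_inj' h3 rfl
    simp_all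
  · obtain ⟨L, X, Y, R, hi, rfl, rfl⟩ := inv_prep h1
    obtain ⟨L2, X2, Y2, R2, hi2, rfl, e⟩ := inv_prep h2
    have e' : (L ++ [X]) ++ (n :: Y) :: R = (L2 ++ [X2]) ++ (n :: Y2) :: R2 := by simpa using e
    obtain ⟨h3, h4, h5⟩ := mid_inj (n := n) e' (by simp) (by simp)
      (fun X hX => w1.fresh (by simp at hX ⊢; tauto)) (fun X hX => w2.fresh (by simp at hX ⊢; tauto))
    obtain ⟨h6, h7⟩ := List.append_inj' h3 rfl
    simp_all

theorem child_exists (n : ℕ) (b : Bool) {t : Bool} {i : ℕ} {c : Cfg} (h : i + t.toNat < c.length) :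
    ∃ c', Child n b t i c c' := by
  obtain ⟨L, X, R, rfl, rfl⟩ : ∃ L X R, c = L ++ X :: R ∧ L.length = i := by
    have hi : i < List.length c := by omega
    refine ⟨List.take i c, List.get c ⟨i, hi⟩, List.drop (i + 1) c, by simp, by simp; omega⟩
  cases t
  · cases b
    · exact ⟨_, Child.app L X R⟩
    · exact ⟨_, Child.new L X R⟩
  · cases R with
    | nil => simp at h
    | cons Y R =>
      cases b
      · exact ⟨_, Child.join L X Y R⟩
      · exact ⟨_, Child.prep L X Y R⟩

theorem child_parent {n : ℕ} {c' : Cfg} (h : wf (n + 1) c') :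
    ∃ b t i c, Child n b t i c c' ∧ wf n c := by
  have hn : n ∈ c'.flatten := h.pm.symm.subset (by simp)
  obtain ⟨Z, hZ, hnZ⟩ := List.mem_flatten.1 hn
  obtain ⟨L, R, rfl⟩ := List.append_of_mem hZ
  obtain ⟨A, B, rfl⟩ := List.append_of_mem hnZ
  have main : ∀ b t i c, Child n b t i c (L ++ (A ++ n :: B) :: R) → (∀ X ∈ c.tail, X ≠ []) →
      c ≠ [] → ∃ b t i c, Child n b t i c (L ++ (A ++ n :: B) :: R) ∧ wf n c := by
    intro b t i c hch htl hne
    refine ⟨b, t, i, c, hch, hne, htl, ?_⟩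
    have hp := perm_child hch
    have h2 : (List.range (n + 1)).Perm (n :: List.range n) := by
      rw [List.range_succ]; exact List.perm_append_singleton _ _
    exact (List.perm_cons n).1 ((hp.symm.trans h.pm).trans h2)
  have htl := h.tl
  rcases List.eq_nil_or_concat L with rfl | ⟨L, X, rfl⟩
  · by_cases hB : B = []
    · subst hB
      exact main _ _ _ _ (Child.app [] A R) (by simpa using htl) (by simp)
    · refine main _ _ _ _ (Child.join [] A B R) ?_ (by simp)
      simp at htl ⊢
      exact ⟨hB, htl⟩
  · have hc : ∀ X' ∈ ((L ++ [X]) ++ R).tail, X' ≠ [] := by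
      intro X' hX'
      apply htl
      cases L <;> simp at hX' ⊢ <;> tauto
    simp only [List.concat_eq_append, List.append_assoc, List.singleton_append] at *
    by_cases hA : A = []
    · subst hA
      by_cases hB : B = []
      · subst hB
        exact main _ _ _ _ (Child.new L X R) hc (by simp)
      · refine main _ _ _ _ (Child.prep L X B R) ?_ (by simp)
        cases L <;> simp at hc ⊢ <;> grind
    · by_cases hB : B = []
      · subst hB
        have := Child.app (n := n) (L ++ [X]) A R
        simp only [List.append_assoc, List.singleton_append] at this
        refine main _ _ _ _ this ?_ (by simp)
        cases L <;> simp at hc ⊢ <;> grind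
      · have := Child.join (n := n) (L ++ [X]) A B R
        simp only [List.append_assoc, List.singleton_append] at this
        refine main _ _ _ _ this ?_ (by simp)
        cases L <;> simp at hc ⊢ <;> grind

theorem LA_iff {c : Cfg} {x : ℕ} : LA c x ↔ ∃ i, i < c.length ∧ alA c i ∧ ee c i = x := by
  constructor
  · rintro ⟨U, R, hU, rfl, h1, h2⟩
    have hl : List.length U = (List.length U - 1) + 1 := by
      have := List.length_pos_iff.2 hU
      omega
    refine ⟨List.length U - 1, ?_, (alA_split hl).2 h1, (ee_split hl).trans h2⟩
    rw [List.length_append]; omega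
  · rintro ⟨i, hi, h1, h2⟩
    exact ⟨c.take (i + 1), c.drop (i + 1), by cases c <;> simp at hi ⊢, by simp, h1, h2⟩

theorem LB_iff {c : Cfg} {x : ℕ} : LB c x ↔ x < c.length ∧ alB c x := by
  constructor
  · rintro ⟨U, R, hU, rfl, h1⟩
    refine ⟨?_, (alB_split hU).2 h1⟩
    rw [List.length_append]; omega
  · rintro ⟨hi, h1⟩
    exact ⟨c.take (x + 1), c.drop (x + 1), by simp; omega, by simp, h1⟩

theorem ee_lt {c : Cfg} {i j : ℕ} (h : alA c i) (hij : i < j) (hj : j < c.length) :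
    ee c i < ee c j := by
  obtain ⟨U, S, R, rfl, hU, hS⟩ : ∃ U S R, c = U ++ (S ++ R) ∧ List.length U = i + 1 ∧
      List.length S = j - i := by
    refine ⟨c.take (i + 1), (c.drop (i + 1)).take (j - i), (c.drop (i + 1)).drop (j - i), ?_, ?_, ?_⟩
    · simp only [List.take_append_drop]
    · simp; omega
    · simp; omega
  have h2 := mono_e (U := U) (S := S) (R := R) (by rintro rfl; simp at hU) ((alA_split hU).1 h)
  rw [ee_split hU, ← List.append_assoc, ee_split (by simp [hU, hS]; omega)]
  omega

theorem ee_last {c : Cfg} {k : ℕ} (hk : k + 1 = c.length) : ee c k = k ∧ alA c k := by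
  rw [ee, alA, hk]
  simp [gtAll]
  omega

theorem ee_inj {c : Cfg} {i j : ℕ} (hi : i < c.length) (hj : j < c.length) (h1 : alA c i)
    (h2 : alA c j) (h : ee c i = ee c j) : i = j := by
  rcases lt_trichotomy i j with h3 | h3 | h3
  · have := ee_lt h1 h3 hj; omega
  · exact h3
  · have := ee_lt h2 h3 hi; omega

theorem ee_bound {c : Cfg} {i : ℕ} (hi : i < c.length) (h : alA c i) :
    ee c i < c.length ∧ (ee c i + 1 = c.length ↔ i + 1 = c.length) := by
  obtain ⟨h1, h2⟩ := ee_last (c := c) (k := c.length - 1) (by omega)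
  rcases Nat.lt_or_ge i (c.length - 1) with h3 | h3
  · have := ee_lt h h3 (by omega)
    omega
  · have : i = c.length - 1 := by omega
    subst this
    omega

inductive Rel : ℕ → Cfg → Cfg → Prop
  | base : Rel 0 [[]] [[]]
  | step {n : ℕ} {c d c' d' : Cfg} {b t : Bool} {i j : ℕ} (h : Rel n c d)
      (h1 : Child n b t i c c') (h2 : Child n b t j d d') (h3 : alA c i) (h4 : alB d j)
      (h5 : j = ee c i) : Rel (n + 1) c' d'

structure Inv (N n : ℕ) (c d : Cfg) : Prop where
  wc : wf n c
  wd' : wf n d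
  ca : ¬ CA (wd N c)
  cb : ¬ CB (wd N d)
  len : c.length = d.length
  lab : ∀ x, LA c x ↔ LB d x
  tt : ∀ x, TT N (wd N c) x ↔ TT N (wd N d) x
  bb : ∀ x, BB N (wd N c) x ↔ BB N (wd N d) x
  rr : ∀ x, RR N (wd N c) x ↔ RR N (wd N d) x

theorem wf_zero : wf 0 [[]] := ⟨by simp, by simp, by simp⟩

theorem eq_of_wf_zero {c : Cfg} (h : wf 0 c) : c = [[]] := by
  have h1 := h.ne
  have h2 := h.tl
  have h3 := h.pm
  simp at h3
  cases c with
  | nil => simp at h1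
  | cons A c =>
    cases c with
    | nil => simpa using h3
    | cons B c =>
      simp at h3 h2
      exact absurd h3.2.1 h2.1

theorem Rel.inv {N n : ℕ} {c d : Cfg} (h : Rel n c d) : n ≤ N → Inv N n c d := by
  induction h with
  | base =>
    intro _
    refine ⟨wf_zero, wf_zero, ?_, ?_, rfl, ?_, by simp, by simp, by simp⟩
    · rintro ⟨a, b, c, d, h, _⟩
      simp [wd, S4] at h
    · rintro ⟨a, b, c, d, h, _⟩
      simp [wd, S4] at h
    · intro x
      rw [LA_iff, LB_iff]
      simp [alA, alB, ee]
      omega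
  | @step n c d c' d' b t i j h h1 h2 h3 h4 h5 ih =>
    intro hn
    have I := ih (by omega)
    have ca' : ¬ CA (wd N c') := by
      rw [(child_CA hn h1 I.wc).1]; simp [I.ca, h3]
    have cb' : ¬ CB (wd N d') := by
      rw [(child_CA hn h2 I.wd').2]; simp [I.cb, h4]
    have l1 := child_length h1
    have l2 := child_length h2
    have hl := I.len
    have hb := ee_bound (c := c) (i := i) (by omega) h3
    refine ⟨wf_child h1 I.wc, wf_child h2 I.wd', ca', cb', by omega, ?_, ?_, ?_, ?_⟩
    · intro x
      rw [LA_step hn h1 I.wc ca' h3, LB_step hn h2 I.wd' I.cb, ← h5]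
      simp only [I.lab]
    · intro x
      rw [(child_stats hn h1 I.wc x).1, (child_stats hn h2 I.wd' x).1, I.tt]
    · intro x
      rw [(child_stats hn h1 I.wc x).2.1, (child_stats hn h2 I.wd' x).2.1, I.bb]
    · intro x
      rw [(child_stats hn h1 I.wc x).2.2, (child_stats hn h2 I.wd' x).2.2, I.rr, ← I.len, h5, hb.2]

theorem Rel.left_total {N : ℕ} : ∀ {n : ℕ} {c : Cfg}, n ≤ N → wf n c → ¬ CA (wd N c) →
    ∃ d, Rel n c d := by
  intro n
  induction n with
  | zero =>
    intro c _ h _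
    rw [eq_of_wf_zero h]
    exact ⟨_, Rel.base⟩
  | succ n ih =>
    intro c' hn hw hA
    obtain ⟨b, t, i, c, hch, hc⟩ := child_parent hw
    have h1 := (child_CA hn hch hc).1
    have hA2 : ¬ CA (wd N c) := by tauto
    have hal : alA c i := by tauto
    obtain ⟨d, hr⟩ := ih (by omega) hc hA2
    have I := hr.inv (N := N) (by omega)
    have hl := child_length hch
    have hb := ee_bound (c := c) (i := i) (by omega) hal
    have hLB : LB d (ee c i) := (I.lab _).1 (LA_iff.2 ⟨i, by omega, hal, rfl⟩)
    have hlen := I.len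
    have htl : t.toNat ≤ 1 := by cases t <;> simp
    obtain ⟨d', hd'⟩ := child_exists n b (t := t) (i := ee c i) (c := d) (by omega)
    exact ⟨d', Rel.step hr hch hd' hal (LB_iff.1 hLB).2 rfl⟩

theorem Rel.right_total {N : ℕ} : ∀ {n : ℕ} {d : Cfg}, n ≤ N → wf n d → ¬ CB (wd N d) →
    ∃ c, Rel n c d := by
  intro n
  induction n with
  | zero =>
    intro c _ h _
    rw [eq_of_wf_zero h]
    exact ⟨_, Rel.base⟩
  | succ n ih =>
    intro d' hn hw hB
    obtain ⟨b, t, j, d, hch, hd⟩ := child_parent hw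
    have h1 := (child_CA hn hch hd).2
    have hB2 : ¬ CB (wd N d) := by tauto
    have hal : alB d j := by tauto
    obtain ⟨c, hr⟩ := ih (by omega) hd hB2
    have I := hr.inv (N := N) (by omega)
    have hl := child_length hch
    have hlen := I.len
    obtain ⟨i, hi, h3, h4⟩ := LA_iff.1 ((I.lab j).2 (LB_iff.2 ⟨by omega, hal⟩))
    have hb := ee_bound (c := c) (i := i) hi h3
    have htl : t.toNat ≤ 1 := by cases t <;> simp
    obtain ⟨c', hc'⟩ := child_exists n b (t := t) (i := i) (c := c) (by omega)
    exact ⟨c', Rel.step hr hc' hch h3 hal h4.symm⟩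

theorem child_bt {n : ℕ} {b1 t1 b2 t2 : Bool} {i1 i2 : ℕ} {c' c1 c2 : Cfg}
    (h1 : Child n b1 t1 i1 c1 c') (h2 : Child n b2 t2 i2 c2 c') (w1 : wf n c1) (w2 : wf n c2) :
    b1 = b2 ∧ t1 = t2 := by
  have nm : ∀ c, wf n c → n ∉ wd (n + 1) c := by
    intro c hc h
    rcases mem_wd h with ⟨X, hX, hx⟩ | h
    · exact hc.fresh hX hx
    · omega
  have nT : ∀ c, wf n c → ¬ TT (n + 1) (wd (n + 1) c) n := by
    rintro c hc ⟨_, y, hy, _⟩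
    exact nm c hc hy.mem.1
  have nB : ∀ c, wf n c → ¬ BB (n + 1) (wd (n + 1) c) n := by
    rintro c hc ⟨_, y, hy, _⟩
    exact nm c hc hy.mem.2
  have s1 := child_stats (Nat.lt_succ_self n) h1 w1 n
  have s2 := child_stats (Nat.lt_succ_self n) h2 w2 n
  have e1 := s1.1.symm.trans s2.1
  have e2 := s1.2.1.symm.trans s2.2.1
  simp [nT c1 w1, nT c2 w2] at e1
  simp [nB c1 w1, nB c2 w2] at e2
  exact ⟨e2, e1⟩

theorem Rel.inv_succ {n : ℕ} {c' d' : Cfg} (h : Rel (n + 1) c' d') :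
    ∃ b t i j c d, Rel n c d ∧ Child n b t i c c' ∧ Child n b t j d d' ∧ alA c i ∧ alB d j ∧
      j = ee c i := by
  cases h with
  | step h h1 h2 h3 h4 h5 => exact ⟨_, _, _, _, _, _, h, h1, h2, h3, h4, h5⟩

theorem Rel.right_unique {n : ℕ} : ∀ {c d1 d2 : Cfg}, Rel n c d1 → Rel n c d2 → d1 = d2 := by
  induction n with
  | zero => intro c d1 d2 h1 h2; cases h1; cases h2; rfl
  | succ n ih =>
    intro c' d1' d2' h1 h2
    obtain ⟨b1, t1, i1, j1, c1, d1, r1, p1, q1, _, _, e1⟩ := h1.inv_succ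
    obtain ⟨b2, t2, i2, j2, c2, d2, r2, p2, q2, _, _, e2⟩ := h2.inv_succ
    have I1 := r1.inv (N := n) le_rfl
    have I2 := r2.inv (N := n) le_rfl
    obtain ⟨rfl, rfl⟩ := child_bt p1 p2 I1.wc I2.wc
    obtain ⟨rfl, rfl⟩ := child_inj p1 p2 I1.wc I2.wc
    have := ih r1 r2
    subst this
    subst e1 e2
    exact child_fun q1 q2

theorem Rel.left_unique {n : ℕ} : ∀ {c1 c2 d : Cfg}, Rel n c1 d → Rel n c2 d → c1 = c2 := by
  induction n with
  | zero => intro c d1 d2 h1 h2; cases h1; cases h2; rfl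
  | succ n ih =>
    intro c1' c2' d' h1 h2
    obtain ⟨b1, t1, i1, j1, c1, d1, r1, p1, q1, a1, _, e1⟩ := h1.inv_succ
    obtain ⟨b2, t2, i2, j2, c2, d2, r2, p2, q2, a2, _, e2⟩ := h2.inv_succ
    have I1 := r1.inv (N := n) le_rfl
    have I2 := r2.inv (N := n) le_rfl
    obtain ⟨rfl, rfl⟩ := child_bt q1 q2 I1.wd' I2.wd'
    obtain ⟨rfl, rfl⟩ := child_inj q1 q2 I1.wd' I2.wd'
    have := ih r1 r2
    subst this
    have l1 := child_length p1
    have l2 := child_length p2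
    have : i1 = i2 := ee_inj (c := c1) (by omega) (by omega) a1 a2 (e1.symm.trans e2)
    subst this
    exact child_fun p1 p2

def ww {n : ℕ} (σ : Equiv.Perm (Fin n)) : List ℕ := List.ofFn (fun i => (σ i : ℕ))

theorem wd_ww {n : ℕ} (σ : Equiv.Perm (Fin n)) : wd n [ww σ] = ww σ ++ [n] := by simp [wd]

theorem ww_lt {n : ℕ} {σ : Equiv.Perm (Fin n)} {x : ℕ} (h : x ∈ ww σ) : x < n := by
  simp [ww, List.mem_ofFn] at h
  obtain ⟨i, rfl⟩ := h
  exact (σ i).2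

theorem ofFn_sublist {k n : ℕ} {h : Fin k → ℕ} {f : Fin n → ℕ} :
    (List.ofFn h).Sublist (List.ofFn f) ↔ ∃ g : Fin k → Fin n, StrictMono g ∧ ∀ i, h i = f (g i) := by
  rw [List.sublist_iff_exists_fin_orderEmbedding_get_eq]
  constructor
  · rintro ⟨g, hg⟩
    refine ⟨fun i => Fin.cast (by simp) (g (Fin.cast (by simp) i)), ?_, ?_⟩
    · intro i j hij
      have := g.strictMono (a := Fin.cast (by simp) i) (b := Fin.cast (by simp) j) hij
      exact this
    · intro i
      have := hg (Fin.cast (by simp) i)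
      simp at this
      exact this
  · rintro ⟨g, hg, he⟩
    refine ⟨OrderEmbedding.ofStrictMono
      (fun i => Fin.cast (by simp) (g (Fin.cast (by simp) i))) ?_, ?_⟩
    · intro i j hij
      exact hg (a := Fin.cast (by simp) i) (b := Fin.cast (by simp) j) hij
    · intro i
      have := he (Fin.cast (by simp) i)
      simp
      exact this

theorem S4_ww {n : ℕ} {σ : Equiv.Perm (Fin n)} {a b c d : ℕ} : S4 a b c d (ww σ) ↔
    ∃ g : Fin 4 → Fin n, StrictMono g ∧ a = σ (g 0) ∧ b = σ (g 1) ∧ c = σ (g 2) ∧ d = σ (g 3) := by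
  have : S4 a b c d (ww σ) ↔ (List.ofFn ![a, b, c, d]).Sublist (ww σ) := by simp [S4]
  rw [this, ww, ofFn_sublist]
  simp [Fin.forall_fin_succ]

theorem CA_ww {n : ℕ} (σ : Equiv.Perm (Fin n)) :
    AvoidsPat (![2, 0, 3, 1] : Fin 4 → Fin 4) σ ↔ ¬ CA (ww σ ++ [n]) := by
  rw [AvoidsPat, not_iff_not]
  constructor
  · rintro ⟨g, hg, h⟩
    refine ⟨σ (g 0), σ (g 1), σ (g 2), σ (g 3), ?_, ?_, ?_, ?_⟩
    · rw [S4_append]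
      exact Or.inl (S4_ww.2 ⟨g, hg, rfl, rfl, rfl, rfl⟩)
    · exact (h 1 3).1 (by decide)
    · exact (h 3 0).1 (by decide)
    · exact (h 0 2).1 (by decide)
  · rintro ⟨a, b, c, d, h, h1, h2, h3⟩
    have h : S4 a b c d (ww σ) := by
      rw [S4_append] at h
      rcases h with h | h | h | h | h
      · exact h
      · have := ww_lt h.1.mem.1
        have := h.2
        simp at this
        omega
      · simp [S2] at h
      · simp [S3] at h
      · simp [S4] at h
    obtain ⟨g, hg, rfl, rfl, rfl, rfl⟩ := S4_ww.1 h
    refine ⟨g, hg, ?_⟩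
    simp only [Fin.forall_fin_succ, Fin.lt_def]
    simp
    omega

theorem CB_ww {n : ℕ} (σ : Equiv.Perm (Fin n)) :
    AvoidsPat (![3, 0, 2, 1] : Fin 4 → Fin 4) σ ↔ ¬ CB (ww σ ++ [n]) := by
  rw [AvoidsPat, not_iff_not]
  constructor
  · rintro ⟨g, hg, h⟩
    refine ⟨σ (g 0), σ (g 1), σ (g 2), σ (g 3), ?_, ?_, ?_, ?_⟩
    · rw [S4_append]
      exact Or.inl (S4_ww.2 ⟨g, hg, rfl, rfl, rfl, rfl⟩)
    · exact (h 1 3).1 (by decide)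
    · exact (h 3 2).1 (by decide)
    · exact (h 2 0).1 (by decide)
  · rintro ⟨a, b, c, d, h, h1, h2, h3⟩
    have h : S4 a b c d (ww σ) := by
      rw [S4_append] at h
      rcases h with h | h | h | h | h
      · exact h
      · have := ww_lt h.1.mem.1
        have := h.2
        simp at this
        omega
      · simp [S2] at h
      · simp [S3] at h
      · simp [S4] at h
    obtain ⟨g, hg, rfl, rfl, rfl, rfl⟩ := S4_ww.1 h
    refine ⟨g, hg, ?_⟩
    simp only [Fin.forall_fin_succ, Fin.lt_def]
    simp
    omega

theorem entry_succ {n : ℕ} {σ : Equiv.Perm (Fin n)} {i : ℕ} (h : i < n) :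
    entry σ (i + 1) = σ ⟨i, h⟩ + 1 := by simp [entry, h]

theorem get_v {n : ℕ} {σ : Equiv.Perm (Fin n)} {i x : ℕ} :
    (ww σ ++ [n])[i]? = some x ↔ (i < n ∧ entry σ (i + 1) = x + 1) ∨ (i = n ∧ x = n) := by
  have hl : (ww σ).length = n := by simp [ww]
  rcases lt_trichotomy i n with h | h | h
  · rw [List.getElem?_append_left (by omega), entry_succ h]
    simp [ww, h]
    omega
  · rw [List.getElem?_append_right (by omega)]
    simp [hl, h]
    omega
  · rw [List.getElem?_append_right (by omega), hl, List.getElem?_eq_none (by simp; omega)]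
    simp
    omega

theorem Adj_iff {x y : ℕ} {w : List ℕ} : Adj x y w ↔ ∃ i : ℕ, w[i]? = some x ∧ w[i + 1]? = some y := by
  constructor
  · rintro ⟨U, V, rfl⟩
    exact ⟨U.length, by simp, by simp⟩
  · rintro ⟨i, h1, h2⟩
    obtain ⟨l1, h1⟩ := List.getElem?_eq_some_iff.1 h1
    obtain ⟨l2, h2⟩ := List.getElem?_eq_some_iff.1 h2
    refine ⟨w.take i, w.drop (i + 2), ?_⟩
    rw [← h1, ← h2]
    simp

theorem S2_iff {x y : ℕ} {w : List ℕ} : S2 x y w ↔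
    ∃ i j : ℕ, i < j ∧ w[i]? = some x ∧ w[j]? = some y := by
  induction w with
  | nil => simp [S2]
  | cons a w ih =>
    rw [S2_cons, ih]
    constructor
    · rintro (⟨rfl, h⟩ | ⟨i, j, h, h1, h2⟩)
      · obtain ⟨j, hj⟩ := List.mem_iff_getElem?.1 h
        exact ⟨0, j + 1, by simp, by simp, by simpa using hj⟩
      · exact ⟨i + 1, j + 1, by omega, by simpa using h1, by simpa using h2⟩
    · rintro ⟨i, j, h, h1, h2⟩
      obtain ⟨j, rfl⟩ : ∃ j', j = j' + 1 := ⟨j - 1, by omega⟩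
      simp at h2
      cases i with
      | zero =>
        simp at h1
        exact Or.inl ⟨h1.symm, List.mem_iff_getElem?.2 ⟨j, h2⟩⟩
      | succ i =>
        simp at h1
        exact Or.inr ⟨i, j, by omega, h1, h2⟩

theorem entry_inj {n : ℕ} {σ : Equiv.Perm (Fin n)} {i j : ℕ} (hi : i < n) (hj : j < n)
    (h : entry σ (i + 1) = entry σ (j + 1)) : i = j := by
  rw [entry_succ hi, entry_succ hj] at h
  have : σ ⟨i, hi⟩ = σ ⟨j, hj⟩ := Fin.ext (by omega)
  simpa using this

theorem entry_range {n : ℕ} {σ : Equiv.Perm (Fin n)} {i : ℕ} (hi : i < n) :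
    1 ≤ entry σ (i + 1) ∧ entry σ (i + 1) ≤ n := by
  rw [entry_succ hi]
  have := (σ ⟨i, hi⟩).2
  omega

theorem entry_surj {n : ℕ} {σ : Equiv.Perm (Fin n)} {x : ℕ} (hx : 1 ≤ x ∧ x ≤ n) :
    ∃ i, i < n ∧ entry σ (i + 1) = x := by
  refine ⟨σ.symm ⟨x - 1, by omega⟩, (σ.symm _).2, ?_⟩
  rw [entry_succ (σ.symm _).2]
  simp
  omega

theorem mem_Destop {n : ℕ} {σ : Equiv.Perm (Fin n)} {x : ℕ} : x ∈ Destop σ ↔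
    ∃ i, i + 1 < n ∧ entry σ (i + 1 + 1) < entry σ (i + 1) ∧ entry σ (i + 1) = x := by
  simp only [Destop, Des, Finset.mem_image, Finset.mem_filter, Finset.mem_Icc]
  constructor
  · rintro ⟨i, ⟨⟨h1, h2⟩, h3⟩, h4⟩
    obtain ⟨i, rfl⟩ : ∃ j, i = j + 1 := ⟨i - 1, by omega⟩
    exact ⟨i, by omega, h3, h4⟩
  · rintro ⟨i, h1, h2, h3⟩
    exact ⟨i + 1, ⟨by omega, h2⟩, h3⟩

theorem mem_Desbot {n : ℕ} {σ : Equiv.Perm (Fin n)} {x : ℕ} : x ∈ Desbot σ ↔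
    ∃ i, i + 1 < n ∧ entry σ (i + 1 + 1) < entry σ (i + 1) ∧ entry σ (i + 1 + 1) = x := by
  simp only [Desbot, Des, Finset.mem_image, Finset.mem_filter, Finset.mem_Icc]
  constructor
  · rintro ⟨i, ⟨⟨h1, h2⟩, h3⟩, h4⟩
    obtain ⟨i, rfl⟩ : ∃ j, i = j + 1 := ⟨i - 1, by omega⟩
    exact ⟨i, by omega, h3, h4⟩
  · rintro ⟨i, h1, h2, h3⟩
    exact ⟨i + 1, ⟨by omega, h2⟩, h3⟩

theorem mem_Ascbot {n : ℕ} {σ : Equiv.Perm (Fin n)} {x : ℕ} : x ∈ Ascbot σ ↔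
    ∃ i, i + 1 < n ∧ entry σ (i + 1) < entry σ (i + 1 + 1) ∧ entry σ (i + 1) = x := by
  simp only [Ascbot, Asc, Finset.mem_image, Finset.mem_filter, Finset.mem_Icc]
  constructor
  · rintro ⟨i, ⟨⟨h1, h2⟩, h3⟩, h4⟩
    obtain ⟨i, rfl⟩ : ∃ j, i = j + 1 := ⟨i - 1, by omega⟩
    exact ⟨i, by omega, h3, h4⟩
  · rintro ⟨i, h1, h2, h3⟩
    exact ⟨i + 1, ⟨by omega, h2⟩, h3⟩

theorem mem_RLmin {n : ℕ} {σ : Equiv.Perm (Fin n)} {x : ℕ} : x ∈ RLmin σ ↔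
    ∃ i, i < n ∧ (∀ j, i < j → j < n → entry σ (i + 1) < entry σ (j + 1)) ∧ entry σ (i + 1) = x := by
  simp only [RLmin, Finset.mem_image, Finset.mem_filter, Finset.mem_Icc]
  constructor
  · rintro ⟨i, ⟨⟨h1, h2⟩, h3⟩, h4⟩
    obtain ⟨i, rfl⟩ : ∃ j, i = j + 1 := ⟨i - 1, by omega⟩
    exact ⟨i, by omega, fun j hj hn => h3 (j + 1) (by omega) (by omega), h4⟩
  · rintro ⟨i, h1, h2, h3⟩
    refine ⟨i + 1, ⟨by omega, ?_⟩, h3⟩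
    intro j hj hn
    obtain ⟨j, rfl⟩ : ∃ k, j = k + 1 := ⟨j - 1, by omega⟩
    exact h2 j (by omega) (by omega)

theorem Destop_TT {n : ℕ} {σ : Equiv.Perm (Fin n)} {x : ℕ} : x ∈ Destop σ ↔
    ∃ y, x = y + 1 ∧ TT n (ww σ ++ [n]) y := by
  rw [mem_Destop]
  simp only [TT, Adj_iff, get_v]
  constructor
  · rintro ⟨i, h1, h2, rfl⟩
    have r1 := entry_range (σ := σ) (i := i) (by omega)
    have r2 := entry_range (σ := σ) (i := i + 1) (by omega)
    refine ⟨entry σ (i + 1) - 1, by omega, by omega, entry σ (i + 1 + 1) - 1,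
      ⟨i, Or.inl ⟨by omega, by omega⟩, Or.inl ⟨by omega, by omega⟩⟩, by omega⟩
  · rintro ⟨y, rfl, h1, z, ⟨i, h2, h3⟩, h4⟩
    exact ⟨i, by omega, by omega, by omega⟩

theorem Desbot_BB {n : ℕ} {σ : Equiv.Perm (Fin n)} {x : ℕ} : x ∈ Desbot σ ↔
    ∃ y, x = y + 1 ∧ BB n (ww σ ++ [n]) y := by
  rw [mem_Desbot]
  simp only [BB, Adj_iff, get_v]
  constructor
  · rintro ⟨i, h1, h2, rfl⟩
    have r1 := entry_range (σ := σ) (i := i) (by omega)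
    have r2 := entry_range (σ := σ) (i := i + 1) (by omega)
    refine ⟨entry σ (i + 1 + 1) - 1, by omega, by omega, entry σ (i + 1) - 1,
      ⟨i, Or.inl ⟨by omega, by omega⟩, Or.inl ⟨by omega, by omega⟩⟩, by omega⟩
  · rintro ⟨y, rfl, h1, z, ⟨i, h2, h3⟩, h4⟩
    exact ⟨i, by omega, by omega, by omega⟩

theorem RLmin_RR {n : ℕ} {σ : Equiv.Perm (Fin n)} {x : ℕ} : x ∈ RLmin σ ↔
    ∃ y, x = y + 1 ∧ RR n (ww σ ++ [n]) y := by
  rw [mem_RLmin]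
  simp only [RR, S2_iff, List.mem_iff_getElem?, get_v]
  constructor
  · rintro ⟨i, h1, h2, rfl⟩
    have r1 := entry_range (σ := σ) (i := i) (by omega)
    refine ⟨entry σ (i + 1) - 1, by omega, by omega, ⟨i, by omega⟩, ?_⟩
    rintro y ⟨i', j, h3, h4, h5⟩
    have hi' : i' < n := by omega
    have : i' = i := entry_inj (σ := σ) hi' h1 (by omega)
    subst this
    rcases h5 with h5 | h5
    · have := h2 j h3 h5.1
      omega
    · omega
  · rintro ⟨y, rfl, h1, ⟨i, h2⟩, h3⟩
    refine ⟨i, by omega, ?_, by omega⟩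
    intro j hij hj
    have r1 := entry_range (σ := σ) (i := j) (by omega)
    have := h3 (entry σ (j + 1) - 1) ⟨i, j, hij, h2, Or.inl ⟨hj, by omega⟩⟩
    omega

theorem last_RLmin {n : ℕ} {σ : Equiv.Perm (Fin (n + 1))} : entry σ (n + 1) ∈ RLmin σ ∧
    ∀ y ∈ RLmin σ, y ≤ entry σ (n + 1) := by
  constructor
  · rw [mem_RLmin]
    exact ⟨n, by omega, by omega, rfl⟩
  · intro y hy
    rw [mem_RLmin] at hy
    obtain ⟨i, h1, h2, rfl⟩ := hy
    rcases Nat.lt_or_ge i n with h | h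
    · exact (h2 n h (by omega)).le
    · have : i = n := by omega
      subst this
      exact le_rfl

theorem Ascbot_iff {n : ℕ} {σ : Equiv.Perm (Fin (n + 1))} {x : ℕ} : x ∈ Ascbot σ ↔
    (1 ≤ x ∧ x ≤ n + 1) ∧ x ∉ Destop σ ∧ x ≠ entry σ (n + 1) := by
  rw [mem_Ascbot, mem_Destop]
  constructor
  · rintro ⟨i, h1, h2, rfl⟩
    refine ⟨entry_range (by omega), ?_, ?_⟩
    · rintro ⟨j, h3, h4, h5⟩
      have : j = i := entry_inj (σ := σ) (by omega) (by omega) h5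
      subst this
      omega
    · intro h
      have : i = n := entry_inj (σ := σ) (by omega) (by omega) h
      omega
  · rintro ⟨h1, h2, h3⟩
    obtain ⟨i, hi, rfl⟩ := entry_surj (σ := σ) h1
    have hin : i ≠ n := by rintro rfl; exact h3 rfl
    refine ⟨i, by omega, ?_, rfl⟩
    by_contra h
    rcases Nat.lt_or_ge (entry σ (i + 1 + 1)) (entry σ (i + 1)) with h4 | h4
    · exact h2 ⟨i, by omega, h4, rfl⟩
    · have h5 : entry σ (i + 1) = entry σ (i + 1 + 1) := by omega
      have := entry_inj (σ := σ) (by omega) (by omega) h5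
      omega

theorem Ascbot_eq {n : ℕ} {σ τ : Equiv.Perm (Fin n)} (h1 : Destop σ = Destop τ)
    (h2 : RLmin σ = RLmin τ) : Ascbot σ = Ascbot τ := by
  cases n with
  | zero => ext x; simp [mem_Ascbot]
  | succ n =>
    have s := last_RLmin (σ := σ)
    have t := last_RLmin (σ := τ)
    have e : entry σ (n + 1) = entry τ (n + 1) :=
      le_antisymm (t.2 _ (h2 ▸ s.1)) (s.2 _ (h2 ▸ t.1))
    ext x
    rw [Ascbot_iff, Ascbot_iff, h1, e]

theorem wf_ww {n : ℕ} (σ : Equiv.Perm (Fin n)) : wf n [ww σ] := by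
  refine ⟨by simp, by simp, ?_⟩
  simp only [List.flatten_cons, List.flatten_nil, List.append_nil]
  rw [List.perm_ext_iff_of_nodup]
  · intro x
    constructor
    · intro h; simpa using ww_lt h
    · intro h
      simp at h
      simp only [ww, List.mem_ofFn]
      exact ⟨σ.symm ⟨x, h⟩, by simp⟩
  · rw [ww, List.nodup_ofFn]
    intro i j h
    exact σ.injective (Fin.ext h)
  · exact List.nodup_range

theorem ww_inj {n : ℕ} {σ τ : Equiv.Perm (Fin n)} (h : ww σ = ww τ) : σ = τ := by
  have := List.ofFn_injective h
  ext i
  exact congrFun this i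

theorem ww_surj {n : ℕ} {d : Cfg} (h : wf n d) (hl : d.length = 1) :
    ∃ τ : Equiv.Perm (Fin n), d = [ww τ] := by
  obtain ⟨u, rfl⟩ := List.length_eq_one_iff.1 hl
  have hp := h.pm
  simp at hp
  have hlen : u.length = n := by simpa using hp.length_eq
  subst hlen
  have hnd : u.Nodup := hp.nodup_iff.2 List.nodup_range
  let f : Fin u.length → Fin u.length := fun i => ⟨u.get i, by
    have := hp.subset (List.get_mem u i)
    simpa using this⟩
  have hf : Function.Injective f := by
    intro i j hij
    have : u.get i = u.get j := congrArg Fin.val hij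
    exact hnd.injective_get this
  refine ⟨Equiv.ofBijective f (Finite.injective_iff_bijective.1 hf), ?_⟩
  simp [ww, f]

theorem rel_stats {n : ℕ} {σ τ : Equiv.Perm (Fin n)} (h : Rel n [ww σ] [ww τ]) :
    AvoidsPat (![2, 0, 3, 1] : Fin 4 → Fin 4) σ ∧ AvoidsPat (![3, 0, 2, 1] : Fin 4 → Fin 4) τ ∧
    Destop σ = Destop τ ∧ Desbot σ = Desbot τ ∧ Ascbot σ = Ascbot τ ∧ Val σ = Val τ ∧
    RLmin σ = RLmin τ := by
  have I := h.inv (N := n) le_rfl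
  have a := I.ca
  have b := I.cb
  have i1 := I.tt
  have i2 := I.bb
  have i3 := I.rr
  rw [wd_ww] at a b i1 i2 i3
  rw [wd_ww] at i1 i2 i3
  have e1 : Destop σ = Destop τ := by ext x; simp only [Destop_TT, i1]
  have e2 : Desbot σ = Desbot τ := by ext x; simp only [Desbot_BB, i2]
  have e3 : RLmin σ = RLmin τ := by ext x; simp only [RLmin_RR, i3]
  have e4 := Ascbot_eq e1 e3
  exact ⟨(CA_ww σ).2 a, (CB_ww τ).2 b, e1, e2, e4, by rw [Val, Val, e2, e4], e3⟩

end Wilf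

open Wilf

/-- The patterns 3142 and 4132 are
`(Destop, Desbot, Ascbot, Val, RLmin)`-Wilf equivalent. -/
theorem wilf_3142_4132 (n : ℕ) (T B A V R : Finset ℕ)
    (hT : T ⊆ Finset.Icc 1 n) (hB : B ⊆ Finset.Icc 1 n) (hA : A ⊆ Finset.Icc 1 n)
    (hV : V ⊆ Finset.Icc 1 n) (hR : R ⊆ Finset.Icc 1 n) :
    ((Finset.univ : Finset (Equiv.Perm (Fin n))).filter
        (fun σ => AvoidsPat (![2, 0, 3, 1] : Fin 4 → Fin 4) σ ∧ Destop σ = T ∧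
          Desbot σ = B ∧ Ascbot σ = A ∧ Val σ = V ∧ RLmin σ = R)).card =
      ((Finset.univ : Finset (Equiv.Perm (Fin n))).filter
        (fun σ => AvoidsPat (![3, 0, 2, 1] : Fin 4 → Fin 4) σ ∧ Destop σ = T ∧
          Desbot σ = B ∧ Ascbot σ = A ∧ Val σ = V ∧ RLmin σ = R)).card := by
  apply le_antisymm
  · apply Finset.card_le_card_of_forall_subsingleton (fun σ τ => Rel n [ww σ] [ww τ])
    · intro σ hσ
      simp only [Finset.mem_filter, Finset.mem_univ, true_and] at hσ
      have hc := (CA_ww σ).1 hσ.1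
      rw [← wd_ww] at hc
      obtain ⟨d, hd⟩ := Rel.left_total le_rfl (wf_ww σ) hc
      have I := hd.inv (N := n) le_rfl
      obtain ⟨τ, rfl⟩ := ww_surj I.wd' (by simpa using I.len.symm)
      obtain ⟨s1, s2, s3, s4, s5, s6, s7⟩ := rel_stats hd
      refine ⟨τ, ?_, hd⟩
      simp only [Finset.mem_filter, Finset.mem_univ, true_and]
      rw [← s3, ← s4, ← s5, ← s6, ← s7]
      exact ⟨s2, hσ.2⟩
    · intro τ _ σ1 h1 σ2 h2
      have := Rel.left_unique h1.2 h2.2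
      exact ww_inj (by simpa using this)
  · apply Finset.card_le_card_of_forall_subsingleton (fun τ σ => Rel n [ww σ] [ww τ])
    · intro τ hτ
      simp only [Finset.mem_filter, Finset.mem_univ, true_and] at hτ
      have hc := (CB_ww τ).1 hτ.1
      rw [← wd_ww] at hc
      obtain ⟨d, hd⟩ := Rel.right_total le_rfl (wf_ww τ) hc
      have I := hd.inv (N := n) le_rfl
      obtain ⟨σ, rfl⟩ := ww_surj I.wc (by simpa using I.len)
      obtain ⟨s1, s2, s3, s4, s5, s6, s7⟩ := rel_stats hd
      refine ⟨σ, ?_, hd⟩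
      simp only [Finset.mem_filter, Finset.mem_univ, true_and]
      rw [s3, s4, s5, s6, s7]
      exact ⟨s1, hτ.2⟩
    · intro σ _ τ1 h1 τ2 h2
      have := Rel.right_unique h1.2 h2.2
      exact ww_inj (by simpa using this)
end

section
/- The patterns 132 and 231 are Des-Wilf equivalent: for every n ≥ 0 and every set D ⊆ [n−1], the number of permutations in Av_n(132) with descent set D equals the number of permutations in Av_n(231) with descent set D. -/
open scoped Classical

section Aux
variable {n : ℕ}

theorem mem_Des_iff (σ : Equiv.Perm (Fin n)) (i : ℕ) :
    i ∈ Des σ ↔ 1 ≤ i ∧ ∃ h : i < n, σ ⟨i, h⟩ < σ ⟨i - 1, by omega⟩ := by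
  unfold Des entry
  simp only [Finset.mem_filter, Finset.mem_Icc, Nat.add_sub_cancel]
  constructor
  · rintro ⟨⟨h1, h2⟩, h3⟩
    have hn : i < n := by omega
    have hn' : i - 1 < n := by omega
    refine ⟨h1, hn, ?_⟩
    rw [dif_pos hn, dif_pos hn'] at h3
    rw [Fin.lt_def]
    omega
  · rintro ⟨h1, hn, h3⟩
    have hn' : i - 1 < n := by omega
    refine ⟨⟨h1, by omega⟩, ?_⟩
    rw [dif_pos hn, dif_pos hn']
    rw [Fin.lt_def] at h3
    omega

theorem contains_021 (σ : Equiv.Perm (Fin n)) :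
    Contains (![0, 2, 1] : Fin 3 → Fin 3) σ ↔
      ∃ a b c : Fin n, a < b ∧ b < c ∧ σ a < σ c ∧ σ c < σ b := by
  constructor
  · rintro ⟨f, hf, h⟩
    refine ⟨f 0, f 1, f 2, hf (by decide), hf (by decide), (h 0 2).1 (by decide),
      (h 2 1).1 (by decide)⟩
  · rintro ⟨a, b, c, hab, hbc, h1, h2⟩
    refine ⟨![a, b, c], ?_, ?_⟩
    · rw [Fin.strictMono_iff_lt_succ]
      intro i
      fin_cases i <;> simpa
    · have h3 := h1.trans h2
      intro i j
      fin_cases i <;> fin_cases j <;> simp [h1, h2, h3, h1.le, h2.le, h3.le]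

theorem contains_120 (σ : Equiv.Perm (Fin n)) :
    Contains (![1, 2, 0] : Fin 3 → Fin 3) σ ↔
      ∃ a b c : Fin n, a < b ∧ b < c ∧ σ c < σ a ∧ σ a < σ b := by
  constructor
  · rintro ⟨f, hf, h⟩
    refine ⟨f 0, f 1, f 2, hf (by decide), hf (by decide), (h 2 0).1 (by decide),
      (h 0 1).1 (by decide)⟩
  · rintro ⟨a, b, c, hab, hbc, h1, h2⟩
    refine ⟨![a, b, c], ?_, ?_⟩
    · rw [Fin.strictMono_iff_lt_succ]
      intro i
      fin_cases i <;> simpa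
    · have h3 := h1.trans h2
      intro i j
      fin_cases i <;> fin_cases j <;> simp [h1, h2, h3, h1.le, h2.le, h3.le]

/-- The end of the right subtree of `i` in the decreasing tree of `σ`. -/
noncomputable def rEnd (σ : Equiv.Perm (Fin n)) (i : Fin n) : ℕ :=
  (Finset.univ.filter (fun k : Fin n => i ≤ k ∧ ∀ j, i < j → j ≤ k → σ j ≤ σ i)).sup
    (fun k => (k : ℕ))

theorem le_rEnd (σ : Equiv.Perm (Fin n)) (i k : Fin n) (h1 : i ≤ k)
    (h2 : ∀ j, i < j → j ≤ k → σ j ≤ σ i) : (k : ℕ) ≤ rEnd σ i :=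
  Finset.le_sup (f := fun k : Fin n => (k : ℕ)) (by simpa using ⟨h1, h2⟩)

theorem exists_post (σ : Equiv.Perm (Fin n)) :
    ∃ τ : Equiv.Perm (Fin n), ∀ i k, i < k →
      (τ i < τ k ↔ ∃ j, i < j ∧ j ≤ k ∧ σ i < σ j) := by
  let K : Fin n → ℕ ×ₗ Fin n := fun i => toLex (rEnd σ i, σ i)
  have hK : Function.Injective K := by
    intro a b h
    have h' : (rEnd σ a, σ a) = (rEnd σ b, σ b) := toLex.injective h
    exact σ.injective (Prod.ext_iff.1 h').2
  have hs : StrictMono (K ∘ Tuple.sort K) :=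
    (Tuple.monotone_sort K).strictMono_of_injective (hK.comp (Equiv.injective _))
  refine ⟨(Tuple.sort K)⁻¹, fun i k hik => ?_⟩
  rw [← hs.lt_iff_lt]
  have e : ∀ x, (K ∘ Tuple.sort K) ((Tuple.sort K)⁻¹ x) = K x := fun x => by simp
  rw [e, e]
  constructor
  · intro h
    by_contra hc
    push Not at hc
    have hr : rEnd σ k ≤ rEnd σ i := by
      apply Finset.sup_le
      intro k' hk'
      simp only [Finset.mem_filter, Finset.mem_univ, true_and] at hk'
      apply le_rEnd σ i k' (hik.le.trans hk'.1)
      intro j hj1 hj2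
      rcases le_or_gt j k with h1 | h1
      · exact hc j hj1 h1
      · exact (hk'.2 j h1 hj2).trans (hc k hik le_rfl)
    have h2 := hc k hik le_rfl
    have : K k ≤ K i := by
      rw [Prod.Lex.le_iff]
      rcases hr.lt_or_eq with h3 | h3
      · exact Or.inl h3
      · exact Or.inr ⟨h3, h2⟩
    exact absurd h (not_lt.2 this)
  · rintro ⟨j, h1, h2, h3⟩
    rw [Prod.Lex.lt_iff]
    left
    change rEnd σ i < rEnd σ k
    have ha : (k : ℕ) ≤ rEnd σ k :=
      le_rEnd σ k k le_rfl (fun j hj hj' => absurd hj (not_lt.2 hj'))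
    refine lt_of_lt_of_le ?_ ha
    have hik' : (i : ℕ) < k := hik
    rw [rEnd, Finset.sup_lt_iff (by rw [Nat.bot_eq_zero]; omega)]
    intro k' hk'
    simp only [Finset.mem_filter, Finset.mem_univ, true_and] at hk'
    by_contra hc
    have hc' : k ≤ k' := by rw [Fin.le_def]; omega
    exact absurd h3 (not_lt.2 (hk'.2 j h1 (h2.trans hc')))

noncomputable def post (σ : Equiv.Perm (Fin n)) : Equiv.Perm (Fin n) := (exists_post σ).choose

theorem post_spec (σ : Equiv.Perm (Fin n)) {i k : Fin n} (h : i < k) :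
    post σ i < post σ k ↔ ∃ j, i < j ∧ j ≤ k ∧ σ i < σ j := (exists_post σ).choose_spec i k h

theorem post_avoids (σ : Equiv.Perm (Fin n)) :
    AvoidsPat (![1, 2, 0] : Fin 3 → Fin 3) (post σ) := by
  rw [AvoidsPat, contains_120]
  rintro ⟨a, b, c, hab, hbc, h1, h2⟩
  obtain ⟨j, h3, h4, h5⟩ := (post_spec σ hab).1 h2
  exact lt_asymm h1 ((post_spec σ (hab.trans hbc)).2 ⟨j, h3, h4.trans hbc.le, h5⟩)

theorem perm_not_lt (σ : Equiv.Perm (Fin n)) {i k : Fin n} (h : i ≠ k) :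
    σ i < σ k ↔ ¬ σ k < σ i := by
  have : σ i ≠ σ k := fun h' => h (σ.injective h')
  rw [not_lt]
  exact ⟨le_of_lt, fun h' => lt_of_le_of_ne h' this⟩

theorem post_Des (σ : Equiv.Perm (Fin n)) : Des (post σ) = Des σ := by
  ext i
  rw [mem_Des_iff, mem_Des_iff]
  refine and_congr_right fun h1 => exists_congr fun h => ?_
  have hlt : (⟨i - 1, by omega⟩ : Fin n) < ⟨i, h⟩ := by rw [Fin.lt_def]; simp only; omega
  rw [perm_not_lt _ hlt.ne', perm_not_lt _ hlt.ne', not_iff_not, post_spec σ hlt]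
  constructor
  · rintro ⟨j, h2, h3, h4⟩
    have : j = ⟨i, h⟩ := by
      rw [Fin.lt_def] at h2
      rw [Fin.le_def] at h3
      ext
      simp only at *
      omega
    rwa [this] at h4
  · intro h4
    exact ⟨_, hlt, le_rfl, h4⟩

theorem lt_iff_post {σ : Equiv.Perm (Fin n)} (hσ : AvoidsPat (![0, 2, 1] : Fin 3 → Fin 3) σ)
    {i k : Fin n} (h : i < k) :
    σ i < σ k ↔ ∀ j, i ≤ j → j < k → post σ j < post σ k := by
  rw [AvoidsPat, contains_021] at hσ
  constructor
  · intro h1 j hj1 hj2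
    rw [post_spec σ hj2]
    refine ⟨k, hj2, le_rfl, ?_⟩
    rcases hj1.eq_or_lt with rfl | hj1
    · exact h1
    · rw [perm_not_lt _ hj2.ne]
      exact fun h2 => hσ ⟨i, j, k, hj1, hj2, h1, h2⟩
  · intro h1
    obtain ⟨m, hm, hmax⟩ := Finset.exists_max_image (Finset.Icc i k) σ ⟨i, by simp [h.le]⟩
    rw [Finset.mem_Icc] at hm
    have hmk : m = k := by
      by_contra hne
      have hlt := lt_of_le_of_ne hm.2 hne
      obtain ⟨j, h2, h3, h4⟩ := (post_spec σ hlt).1 (h1 m hm.1 hlt)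
      exact absurd h4 (not_lt.2 (hmax j (Finset.mem_Icc.2 ⟨hm.1.trans h2.le, h3⟩)))
    subst hmk
    rw [perm_not_lt _ h.ne, not_lt]
    exact hmax i (Finset.mem_Icc.2 ⟨le_rfl, h.le⟩)

theorem perm_ext_of_lt {σ τ : Equiv.Perm (Fin n)}
    (h : ∀ i k, i < k → (σ i < σ k ↔ τ i < τ k)) : σ = τ := by
  have h' : ∀ i k, σ i < σ k → τ i < τ k := by
    intro i k hik
    rcases lt_trichotomy i k with h1 | h1 | h1
    · exact (h i k h1).1 hik
    · subst h1; exact absurd hik (lt_irrefl _)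
    · rw [perm_not_lt _ h1.ne', ← h k i h1]
      exact lt_asymm hik
  have hm : StrictMono (fun x => τ (σ.symm x)) := by
    intro a b hab
    apply h'
    simpa using hab
  have hid : (σ.symm.trans τ : Fin n → Fin n) = id := by
    have := Subsingleton.elim
      (hm.orderIsoOfSurjective _ (σ.symm.trans τ).surjective) (OrderIso.refl (Fin n))
    funext x
    exact congrArg (fun e : Fin n ≃o Fin n => e x) this
  ext x
  have := congrFun hid (σ x)
  simp at this
  rw [this]

theorem card_le_post (D : Finset ℕ) :
    ((Finset.univ : Finset (Equiv.Perm (Fin n))).filter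
        (fun σ => AvoidsPat (![0, 2, 1] : Fin 3 → Fin 3) σ ∧ Des σ = D)).card ≤
      ((Finset.univ : Finset (Equiv.Perm (Fin n))).filter
        (fun σ => AvoidsPat (![1, 2, 0] : Fin 3 → Fin 3) σ ∧ Des σ = D)).card := by
  apply Finset.card_le_card_of_injOn post
  · intro σ hσ
    simp only [Finset.coe_filter, Finset.mem_univ, true_and, Set.mem_ofPred_eq] at hσ ⊢
    exact ⟨post_avoids σ, (post_Des σ).trans hσ.2⟩
  · intro σ hσ τ hτ he
    simp only [Finset.coe_filter, Finset.mem_univ, true_and, Set.mem_ofPred_eq] at hσ hτ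
    apply perm_ext_of_lt
    intro i k hik
    rw [lt_iff_post hσ.1 hik, lt_iff_post hτ.1 hik, he]

/-- The reversed complement of a descent set. -/
def revD (n : ℕ) (D : Finset ℕ) : Finset ℕ := (Finset.Icc 1 (n - 1)).filter (fun i => n - i ∉ D)

theorem revD_revD (D : Finset ℕ) (hD : D ⊆ Finset.Icc 1 (n - 1)) : revD n (revD n D) = D := by
  ext i
  simp only [revD, Finset.mem_filter, Finset.mem_Icc, not_and, not_not]
  constructor
  · rintro ⟨h1, h2⟩
    have := h2 (by omega)
    rwa [show n - (n - i) = i by omega] at this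
  · intro h
    have h1 := Finset.mem_Icc.1 (hD h)
    refine ⟨h1, fun _ => ?_⟩
    rwa [show n - (n - i) = i by omega]

theorem rev_Des (σ : Equiv.Perm (Fin n)) : Des (Fin.revPerm.trans σ) = revD n (Des σ) := by
  ext i
  simp only [revD, Finset.mem_filter, mem_Des_iff, Finset.mem_Icc]
  by_cases hi : 1 ≤ i ∧ i < n
  · obtain ⟨h1, h2⟩ := hi
    have e1 : Fin.rev (⟨i, h2⟩ : Fin n) = ⟨n - i - 1, by omega⟩ := by
      ext; simp [Fin.val_rev]; omega
    have e2 : Fin.rev (⟨i - 1, by omega⟩ : Fin n) = ⟨n - i, by omega⟩ := by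
      ext; simp [Fin.val_rev]; omega
    have hne : (⟨n - i - 1, by omega⟩ : Fin n) ≠ ⟨n - i, by omega⟩ := by
      rw [Ne, Fin.mk.injEq]; omega
    simp only [Equiv.trans_apply, Fin.revPerm_apply, e1, e2]
    constructor
    · rintro ⟨_, _, h⟩
      exact ⟨by omega, fun ⟨_, _, h'⟩ => lt_asymm h h'⟩
    · rintro ⟨_, h⟩
      refine ⟨h1, h2, ?_⟩
      rw [perm_not_lt _ hne]
      exact fun h' => h ⟨by omega, by omega, h'⟩
  · constructor
    · rintro ⟨h1, h2, _⟩
      exact absurd ⟨h1, h2⟩ hi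
    · rintro ⟨h1, _⟩
      exact absurd ⟨h1.1, by omega⟩ hi

theorem card_le_rev (D : Finset ℕ) :
    ((Finset.univ : Finset (Equiv.Perm (Fin n))).filter
        (fun σ => AvoidsPat (![1, 2, 0] : Fin 3 → Fin 3) σ ∧ Des σ = D)).card ≤
      ((Finset.univ : Finset (Equiv.Perm (Fin n))).filter
        (fun σ => AvoidsPat (![0, 2, 1] : Fin 3 → Fin 3) σ ∧ Des σ = revD n D)).card := by
  apply Finset.card_le_card_of_injOn (fun σ => Fin.revPerm.trans σ)
  · intro σ hσ
    simp only [Finset.coe_filter, Finset.mem_univ, true_and, Set.mem_ofPred_eq] at hσ ⊢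
    refine ⟨?_, by rw [rev_Des, hσ.2]⟩
    have h := hσ.1
    rw [AvoidsPat, contains_120] at h
    rw [AvoidsPat, contains_021]
    rintro ⟨a, b, c, hab, hbc, h1, h2⟩
    exact h ⟨c.rev, b.rev, a.rev, Fin.rev_lt_rev.2 hbc, Fin.rev_lt_rev.2 hab, h1, h2⟩
  · intro σ _ τ _ he
    ext x
    have := congrArg (fun e : Equiv.Perm (Fin n) => e x.rev) he
    simp at this
    rw [this]

end Aux

/-- The patterns 132 and 231 are Des-Wilf equivalent. -/
theorem des_wilf_132_231 (n : ℕ) (D : Finset ℕ) (hD : D ⊆ Finset.Icc 1 (n - 1)) :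
    ((Finset.univ : Finset (Equiv.Perm (Fin n))).filter
        (fun σ => AvoidsPat (![0, 2, 1] : Fin 3 → Fin 3) σ ∧ Des σ = D)).card =
      ((Finset.univ : Finset (Equiv.Perm (Fin n))).filter
        (fun σ => AvoidsPat (![1, 2, 0] : Fin 3 → Fin 3) σ ∧ Des σ = D)).card := by
  apply le_antisymm (card_le_post D)
  calc _ ≤ _ := card_le_rev D
    _ ≤ _ := card_le_post _
    _ ≤ _ := card_le_rev _
    _ = _ := by rw [revD_revD D hD]
end
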